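/- Let a < b, Ω = (c,d) ⊂ ℝ, 𝒰 = (a,b) × Ω, let X ∈ C¹([a,b]; Ω) and write 𝒞 = {(t,X(t)) : t ∈ (a,b)}. Let u_L, u_R, p_L, p_R ∈ C¹([a,b] × [c,d]; ℝ), let w ∈ C¹((a,b)) with w ≥ 0, and let v_L, v_R be C¹ on 𝒰 \ 𝒞 and integrable on 𝒰, with v defined by v(t,x) = v_L(t,x) for x < X(t) and v(t,x) = v_R(t,x) for x > X(t), and similarly u(t,x) = u_L(t,x) for x < X(t), u_R(t,x) for x > X(t), and p(t,x) = p_L(t,x) for x < X(t), p_R(t,x) for x > X(t). Suppose the Lagrangian gas dynamics equations hold in the sense of distributions on 𝒰 with V(t) = v(t,·)dx + w(t)δ_{X(t)}: for every φ ∈ C_c^∞(𝒰), (I) ∫∫_𝒰 v ∂_t φ dx dt + ∫_a^b w(t) ∂_t φ(t, X(t)) dt = ∫∫_𝒰 u ∂_x φ dx dt, and (II) ∫∫_𝒰 u ∂_t φ dx dt + ∫∫_𝒰 p ∂_x φ dx dt = 0. Write [g](t) = g_R(t,X(t)) − g_L(t,X(t)). Then: (i) w(t) X'(t) = 0 for all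 t ∈ (a,b); (ii) X'(t)[u](t) = [p](t) for all t ∈ (a,b); (iii) at every t at which the one-sided limits v_L(t,X(t)−) and v_R(t,X(t)+) exist and are finite, [u](t) = w'(t) − X'(t)(v_R(t,X(t)+) − v_L(t,X(t)−)); in particular, at every t with w(t) > 0 one has X'(t) = 0, and if moreover the above limits are finite or X'(t)=0, then w'(t) = [u](t). -/

import Mathlib

open MeasureTheory Set Filter Topology

/-- A smooth nondecreasing step from `0` to `1`: at scale `1 / n`, it rises on
`[p - e / n, p + (1 - e) / n]`. -/
noncomputable def smoothStep (n : ℕ) (p e x : ℝ) : ℝ :=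
  Real.smoothTransition (n * (x - p) + e)

/-- A smooth cutoff equal to `1` on `[p, q]` and vanishing outside `[p - 1 / n, q + 1 / n]`. -/
noncomputable def smoothCutoff (n : ℕ) (p q x : ℝ) : ℝ :=
  smoothStep n p 1 x - smoothStep n q 0 x

lemma smoothStep_contDiff (n : ℕ) (p e : ℝ) {k : ℕ∞} : ContDiff ℝ k (smoothStep n p e) := by
  unfold smoothStep
  exact Real.smoothTransition.contDiff.comp (by fun_prop)

lemma smoothStep_monotone (n : ℕ) (p e : ℝ) : Monotone (smoothStep n p e) := by
  intro x y hxy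
  apply Real.smoothTransition.monotone
  gcongr

lemma smoothStep_continuous_deriv (n : ℕ) (p e : ℝ) : Continuous (deriv (smoothStep n p e)) :=
  (smoothStep_contDiff n p e (k := 1)).continuous_deriv le_rfl

lemma smoothStep_deriv_nonneg (n : ℕ) (p e x : ℝ) : 0 ≤ deriv (smoothStep n p e) x :=
  (smoothStep_monotone n p e).deriv_nonneg

lemma smoothStep_of_deriv_ne_zero {n : ℕ} {p e x : ℝ} (h : deriv (smoothStep n p e) x ≠ 0) :
    0 < n * (x - p) + e ∧ n * (x - p) + e < 1 := by
  constructor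
  · by_contra! hx
    refine h (IsLocalMin.deriv_eq_zero (Eventually.of_forall fun y => ?_))
    have : smoothStep n p e x = 0 := Real.smoothTransition.zero_of_nonpos hx
    rw [this]
    exact Real.smoothTransition.nonneg _
  · by_contra! hx
    refine h (IsLocalMax.deriv_eq_zero (Eventually.of_forall fun y => ?_))
    have : smoothStep n p e x = 1 := Real.smoothTransition.one_of_one_le hx
    rw [this]
    exact Real.smoothTransition.le_one _

lemma integral_deriv_smoothStep {n : ℕ} {p e a b : ℝ} (hab : a ≤ b)
    (ha : n * (a - p) + e ≤ 0) (hb : 1 ≤ n * (b - p) + e) :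
    ∫ x in Ioo a b, deriv (smoothStep n p e) x = 1 := by
  rw [← integral_Ioc_eq_integral_Ioo, ← intervalIntegral.integral_of_le hab,
    intervalIntegral.integral_deriv_eq_sub
      (fun x _ => ((smoothStep_contDiff n p e (k := 1)).differentiable one_ne_zero) x)
      ((smoothStep_continuous_deriv n p e).intervalIntegrable _ _)]
  simp [smoothStep, Real.smoothTransition.zero_of_nonpos ha,
    Real.smoothTransition.one_of_one_le hb]

lemma MeasureTheory.IntegrableOn.mul_continuous_Ioo {a b : ℝ} {g h : ℝ → ℝ}
    (hg : IntegrableOn g (Ioo a b))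
    (hh : Continuous h) : IntegrableOn (fun x => g x * h x) (Ioo a b) := by
  rw [← integrableOn_Icc_iff_integrableOn_Ioo] at hg ⊢
  exact hg.mul_continuousOn hh.continuousOn isCompact_Icc

lemma eventually_natCast_mul_ge {x : ℝ} (hx : 0 < x) (y : ℝ) : ∀ᶠ n : ℕ in atTop, y ≤ n * x :=
  (tendsto_natCast_atTop_atTop.atTop_mul_const hx).eventually_ge_atTop y

lemma eventually_integral_deriv_smoothStep {p e a b : ℝ} (hp : p ∈ Ioo a b) :
    ∀ᶠ n : ℕ in atTop, ∫ x in Ioo a b, deriv (smoothStep n p e) x = 1 := by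
  filter_upwards [eventually_natCast_mul_ge (sub_pos.2 hp.1) e,
    eventually_natCast_mul_ge (sub_pos.2 hp.2) (1 - e)] with n h1 h2
  exact integral_deriv_smoothStep (hp.1.trans hp.2).le (by linarith) (by linarith)

lemma tendsto_integral_mul_deriv_smoothStep {a b p e A : ℝ} {g : ℝ → ℝ} {s : Set ℝ}
    (hp : p ∈ Ioo a b) (hg : IntegrableOn g (Ioo a b)) (hA : Tendsto g (𝓝[s] p) (𝓝 A))
    (he : ∀ δ > 0, ∀ᶠ n : ℕ in atTop, ∀ x,
      0 < n * (x - p) + e → n * (x - p) + e < 1 → x ∈ s ∧ |x - p| < δ) :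
    Tendsto (fun n : ℕ => ∫ x in Ioo a b, g x * deriv (smoothStep n p e) x) atTop (𝓝 A) := by
  rw [Metric.tendsto_atTop']
  intro ε hε
  obtain ⟨δ, hδ, hδA⟩ := Metric.mem_nhdsWithin_iff.1 (hA (Metric.ball_mem_nhds A (half_pos hε)))
  have key : ∀ᶠ n : ℕ in atTop,
      dist (∫ x in Ioo a b, g x * deriv (smoothStep n p e) x) A < ε := by
    filter_upwards [he δ hδ, eventually_integral_deriv_smoothStep (e := e) hp] with n h1 h2
    have hc := smoothStep_continuous_deriv n p e
    have hi : IntegrableOn (deriv (smoothStep n p e)) (Ioo a b) :=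
      hc.continuousOn.integrableOn_Icc.mono_set Ioo_subset_Icc_self
    have e1 : (∫ x in Ioo a b, g x * deriv (smoothStep n p e) x) - A =
        ∫ x in Ioo a b, (g x * deriv (smoothStep n p e) x
          - A * deriv (smoothStep n p e) x) := by
      rw [integral_sub (hg.mul_continuous_Ioo hc) (hi.const_mul A), integral_const_mul, h2, mul_one]
    rw [Real.dist_eq, e1, ← Real.norm_eq_abs]
    refine lt_of_le_of_lt (norm_integral_le_of_norm_le
      (g := fun x => ε / 2 * deriv (smoothStep n p e) x) (hi.const_mul _) ?_) ?_
    · refine Eventually.of_forall fun x => ?_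
      rw [← sub_mul, norm_mul, Real.norm_of_nonneg (smoothStep_deriv_nonneg n p e x)]
      rcases eq_or_ne (deriv (smoothStep n p e) x) 0 with h0 | h0
      · simp [h0]
      · obtain ⟨l1, l2⟩ := smoothStep_of_deriv_ne_zero h0
        obtain ⟨m1, m2⟩ := h1 x l1 l2
        have : g x ∈ Metric.ball A (ε / 2) := hδA ⟨by simpa [Real.dist_eq] using m2, m1⟩
        exact mul_le_mul_of_nonneg_right (by simpa [Real.dist_eq] using this.le)
          (smoothStep_deriv_nonneg n p e x)
    · rw [integral_const_mul, h2]; linarith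
  obtain ⟨N, hN⟩ := eventually_atTop.1 key
  exact ⟨N, fun n hn => hN n hn.le⟩

lemma tendsto_integral_mul_deriv_smoothCutoff {a b p q A B : ℝ} {g : ℝ → ℝ}
    (hp : p ∈ Ioo a b) (hq : q ∈ Ioo a b) (hg : IntegrableOn g (Ioo a b))
    (hA : Tendsto g (𝓝[<] p) (𝓝 A)) (hB : Tendsto g (𝓝[>] q) (𝓝 B)) :
    Tendsto (fun n : ℕ => ∫ x in Ioo a b, g x * deriv (smoothCutoff n p q) x) atTop
      (𝓝 (A - B)) := by
  have e1 : ∀ n : ℕ, (∫ x in Ioo a b, g x * deriv (smoothCutoff n p q) x) =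
      (∫ x in Ioo a b, g x * deriv (smoothStep n p 1) x)
        - ∫ x in Ioo a b, g x * deriv (smoothStep n q 0) x := by
    intro n
    rw [← integral_sub (hg.mul_continuous_Ioo (smoothStep_continuous_deriv _ _ _))
      (hg.mul_continuous_Ioo (smoothStep_continuous_deriv _ _ _))]
    congr 1
    ext x
    rw [← mul_sub]
    congr 1
    exact deriv_sub ((smoothStep_contDiff n p 1 (k := 1)).differentiable one_ne_zero x)
      ((smoothStep_contDiff n q 0 (k := 1)).differentiable one_ne_zero x)
  simp_rw [e1]
  refine (tendsto_integral_mul_deriv_smoothStep hp hg hA ?_).sub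
    (tendsto_integral_mul_deriv_smoothStep hq hg hB ?_)
  · intro δ hδ
    filter_upwards [eventually_natCast_mul_ge hδ 1, eventually_gt_atTop 0] with n hn hn0 x h1 h2
    have hn0' : (0 : ℝ) < n := by exact_mod_cast hn0
    have : x - p < 0 := by
      by_contra! h
      nlinarith
    refine ⟨by simpa using this, ?_⟩
    rw [abs_of_neg this]
    by_contra! h
    nlinarith
  · intro δ hδ
    filter_upwards [eventually_natCast_mul_ge hδ 1, eventually_gt_atTop 0] with n hn hn0 x h1 h2
    have hn0' : (0 : ℝ) < n := by exact_mod_cast hn0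
    have : 0 < x - q := by
      by_contra! h
      nlinarith
    refine ⟨by simpa using this, ?_⟩
    rw [abs_of_pos this]
    by_contra! h
    nlinarith

lemma smoothCutoff_contDiff (n : ℕ) (p q : ℝ) {k : ℕ∞} : ContDiff ℝ k (smoothCutoff n p q) :=
  (smoothStep_contDiff n p 1).sub (smoothStep_contDiff n q 0)

lemma smoothCutoff_continuous (n : ℕ) (p q : ℝ) : Continuous (smoothCutoff n p q) :=
  (smoothCutoff_contDiff n p q (k := 0)).continuous

lemma smoothCutoff_continuous_deriv (n : ℕ) (p q : ℝ) : Continuous (deriv (smoothCutoff n p q)) :=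
  (smoothCutoff_contDiff n p q (k := 1)).continuous_deriv le_rfl

lemma abs_smoothCutoff_le_one (n : ℕ) (p q x : ℝ) : |smoothCutoff n p q x| ≤ 1 := by
  have h1 := Real.smoothTransition.nonneg (n * (x - p) + 1)
  have h2 := Real.smoothTransition.le_one (n * (x - p) + 1)
  have h3 := Real.smoothTransition.nonneg (n * (x - q) + 0)
  have h4 := Real.smoothTransition.le_one (n * (x - q) + 0)
  unfold smoothCutoff smoothStep
  rw [abs_le]
  constructor <;> linarith

lemma smoothCutoff_tsupport {n : ℕ} {p q : ℝ} (hn : 0 < n) (hpq : p ≤ q) :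
    tsupport (smoothCutoff n p q) ⊆ Icc (p - 1 / n) (q + 1 / n) := by
  have hn0 : (0 : ℝ) < n := by exact_mod_cast hn
  refine closure_minimal (fun x hx => ?_) isClosed_Icc
  by_contra hmem
  refine hx ?_
  have hinv : (n : ℝ) * (1 / n) = 1 := by field_simp
  rcases not_and_or.1 hmem with h | h
  · push Not at h
    unfold smoothCutoff smoothStep
    rw [Real.smoothTransition.zero_of_nonpos (by nlinarith),
      Real.smoothTransition.zero_of_nonpos (by nlinarith), sub_zero]
  · push Not at h
    unfold smoothCutoff smoothStep
    rw [Real.smoothTransition.one_of_one_le (by nlinarith),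
      Real.smoothTransition.one_of_one_le (by nlinarith), sub_self]

lemma smoothCutoff_hasCompactSupport {n : ℕ} {p q : ℝ} (hn : 0 < n) (hpq : p ≤ q) :
    HasCompactSupport (smoothCutoff n p q) :=
  isCompact_Icc.of_isClosed_subset (isClosed_tsupport _) (smoothCutoff_tsupport hn hpq)

lemma eventually_smoothCutoff_tsupport {a b p q : ℝ} (hp : a < p) (hpq : p ≤ q) (hq : q < b) :
    ∀ᶠ n : ℕ in atTop, 0 < n ∧ tsupport (smoothCutoff n p q) ⊆ Ioo a b := by
  filter_upwards [eventually_gt_atTop 0, eventually_natCast_mul_ge (sub_pos.2 hp) 2,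
    eventually_natCast_mul_ge (sub_pos.2 hq) 2] with n hn h1 h2
  have hn0 : (0 : ℝ) < n := by exact_mod_cast hn
  refine ⟨hn, (smoothCutoff_tsupport hn hpq).trans fun x hx => ⟨?_, ?_⟩⟩
  · have : 1 / (n : ℝ) < p - a := by rw [div_lt_iff₀ hn0]; linarith
    linarith [hx.1]
  · have : 1 / (n : ℝ) < b - q := by rw [div_lt_iff₀ hn0]; linarith
    linarith [hx.2]

lemma tendsto_smoothCutoff {p q : ℝ} (hpq : p ≤ q) (x : ℝ) :
    Tendsto (fun n : ℕ => smoothCutoff n p q x) atTop (𝓝 ((Icc p q).indicator 1 x)) := by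
  refine tendsto_const_nhds.congr' ?_
  by_cases hx : x ∈ Icc p q
  · refine Eventually.of_forall fun n => ?_
    have hn0 : (0 : ℝ) ≤ n := n.cast_nonneg
    rw [indicator_of_mem hx]
    simp only [smoothCutoff, smoothStep]
    rw [Real.smoothTransition.one_of_one_le (by nlinarith [hx.1]),
      Real.smoothTransition.zero_of_nonpos (by nlinarith [hx.2])]
    simp
  · rw [indicator_of_notMem hx]
    rcases not_and_or.1 hx with h | h
    · push Not at h
      filter_upwards [eventually_natCast_mul_ge (sub_pos.2 h) 1] with n hn
      have hn0 : (0 : ℝ) ≤ n := n.cast_nonneg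
      unfold smoothCutoff smoothStep
      rw [Real.smoothTransition.zero_of_nonpos (by nlinarith),
        Real.smoothTransition.zero_of_nonpos (by nlinarith), sub_zero]
    · push Not at h
      filter_upwards [eventually_natCast_mul_ge (sub_pos.2 h) 1] with n hn
      have hn0 : (0 : ℝ) ≤ n := n.cast_nonneg
      unfold smoothCutoff smoothStep
      rw [Real.smoothTransition.one_of_one_le (by nlinarith),
        Real.smoothTransition.one_of_one_le (by nlinarith), sub_self]

lemma eventually_integral_abs_deriv_smoothCutoff_le {a b p q : ℝ} (hp : p ∈ Ioo a b)
    (hq : q ∈ Ioo a b) :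
    ∀ᶠ n : ℕ in atTop, ∫ x in Ioo a b, |deriv (smoothCutoff n p q) x| ≤ 2 := by
  filter_upwards [eventually_integral_deriv_smoothStep (e := 1) hp,
    eventually_integral_deriv_smoothStep (e := 0) hq] with n h1 h2
  have hi : ∀ p e, IntegrableOn (deriv (smoothStep n p e)) (Ioo a b) := fun p e =>
    (smoothStep_continuous_deriv n p e).continuousOn.integrableOn_Icc.mono_set Ioo_subset_Icc_self
  have : (2 : ℝ) = ∫ x in Ioo a b, (deriv (smoothStep n p 1) x + deriv (smoothStep n q 0) x) := by
    rw [integral_add (hi _ _) (hi _ _), h1, h2]; norm_num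
  rw [this]
  refine integral_mono_of_nonneg (Eventually.of_forall fun x => abs_nonneg _)
    ((hi _ _).add (hi _ _)) (Eventually.of_forall fun x => ?_)
  have hd : deriv (smoothCutoff n p q) x =
      deriv (smoothStep n p 1) x - deriv (smoothStep n q 0) x :=
    deriv_sub ((smoothStep_contDiff n p 1 (k := 1)).differentiable one_ne_zero x)
      ((smoothStep_contDiff n q 0 (k := 1)).differentiable one_ne_zero x)
  have := smoothStep_deriv_nonneg n p 1 x
  have := smoothStep_deriv_nonneg n q 0 x
  simp only [hd]
  rw [abs_le]
  constructor <;> linarith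

/-- The function equal to `fL t x` for `x < X t` and to `fR t x` otherwise. -/
noncomputable def glued (X : ℝ → ℝ) (fL fR : ℝ → ℝ → ℝ) (t x : ℝ) : ℝ :=
  if x < X t then fL t x else fR t x

/-- The increment of the glued function across `[x₁, x₂]`, with the outer trace at each endpoint. -/
noncomputable def outerIncrement (X : ℝ → ℝ) (fL fR : ℝ → ℝ → ℝ) (x₁ x₂ t : ℝ) : ℝ :=
  glued X fL fR t x₂ - if x₁ ≤ X t then fL t x₁ else fR t x₁

/-- The conservation law `∂ₜ(v dx + w δ_X) = ∂ₓ f` on `(a,b) × (c,d)`, tested against products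
`α(t) β(x)`, where `f` is glued along the curve `x = X t` from two functions that are bounded by `B`
and `K`-Lipschitz in space, and `v` is continuous off the curve. -/
structure CurveLaw (a b c d : ℝ) (X X' : ℝ → ℝ) (fL fR : ℝ → ℝ → ℝ) (w : ℝ → ℝ)
    (v : ℝ → ℝ → ℝ) (K B : ℝ) : Prop where
  hasDerivAt_X : ∀ t ∈ Ioo a b, HasDerivAt X (X' t) t
  continuousOn_X' : ContinuousOn X' (Ioo a b)
  X_mem : ∀ t ∈ Ioo a b, X t ∈ Ioo c d
  fL_cont : ContinuousOn (fun q : ℝ × ℝ => fL q.1 q.2) (Ioo a b ×ˢ Ioo c d)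
  fR_cont : ContinuousOn (fun q : ℝ × ℝ => fR q.1 q.2) (Ioo a b ×ˢ Ioo c d)
  fL_lip : ∀ t ∈ Ioo a b, ∀ x ∈ Ioo c d, ∀ y ∈ Ioo c d, |fL t x - fL t y| ≤ K * |x - y|
  fR_lip : ∀ t ∈ Ioo a b, ∀ x ∈ Ioo c d, ∀ y ∈ Ioo c d, |fR t x - fR t y| ≤ K * |x - y|
  fL_bdd : ∀ t ∈ Ioo a b, ∀ x ∈ Ioo c d, |fL t x| ≤ B
  fR_bdd : ∀ t ∈ Ioo a b, ∀ x ∈ Ioo c d, |fR t x| ≤ B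
  w_cont : ContinuousOn w (Ioo a b)
  w_bdd : ∀ t ∈ Ioo a b, |w t| ≤ B
  v_cont : ∀ t ∈ Ioo a b, ∀ x ∈ Ioo c d, x ≠ X t →
    ContinuousAt (fun q : ℝ × ℝ => v q.1 q.2) (t, x)
  v_int : IntegrableOn (fun q : ℝ × ℝ => v q.1 q.2) (Ioo a b ×ˢ Ioo c d)
  weak : ∀ α β : ℝ → ℝ, ContDiff ℝ (⊤ : ℕ∞) α → ContDiff ℝ (⊤ : ℕ∞) β →
    HasCompactSupport α → HasCompactSupport β → tsupport α ⊆ Ioo a b → tsupport β ⊆ Ioo c d →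
    (∫ t in Ioo a b, deriv α t * ∫ x in Ioo c d, v t x * β x) +
      (∫ t in Ioo a b, w t * (deriv α t * β (X t))) =
      ∫ t in Ioo a b, α t * ∫ x in Ioo c d, glued X fL fR t x * deriv β x

lemma tendsto_integral_mul_smoothCutoff {a b p q : ℝ} {g : ℝ → ℝ} (hp : a < p) (hpq : p ≤ q)
    (hq : q < b) (hg : IntegrableOn g (Ioo a b)) :
    Tendsto (fun n : ℕ => ∫ x in Ioo a b, g x * smoothCutoff n p q x) atTop
      (𝓝 (∫ x in Icc p q, g x)) := by
  have e1 : ∫ x in Icc p q, g x = ∫ x in Ioo a b, g x * (Icc p q).indicator 1 x := by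
    have hsub : Icc p q ⊆ Ioo a b := Icc_subset_Ioo hp hq
    have : ∀ x, g x * (Icc p q).indicator 1 x = (Icc p q).indicator g x := fun x => by
      by_cases hx : x ∈ Icc p q <;> simp [hx]
    simp_rw [this]
    rw [setIntegral_indicator measurableSet_Icc, inter_eq_right.2 hsub]
  rw [e1]
  refine tendsto_integral_of_dominated_convergence (fun x => |g x|)
    (fun n => (hg.mul_continuous_Ioo (smoothCutoff_continuous n p q)).aestronglyMeasurable)
    hg.abs (fun n => Eventually.of_forall fun x => ?_)
    (Eventually.of_forall fun x => (tendsto_smoothCutoff hpq x).const_mul _)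
  rw [Real.norm_eq_abs, abs_mul]
  exact mul_le_of_le_one_right (abs_nonneg _) (abs_smoothCutoff_le_one n p q x)

namespace CurveLaw

variable {a b c d : ℝ} {X X' : ℝ → ℝ} {fL fR : ℝ → ℝ → ℝ} {w : ℝ → ℝ} {v : ℝ → ℝ → ℝ} {K B : ℝ}

lemma continuousAt_X (h : CurveLaw a b c d X X' fL fR w v K B) {t : ℝ} (ht : t ∈ Ioo a b) :
    ContinuousAt X t := (h.hasDerivAt_X t ht).continuousAt

lemma continuousOn_X (h : CurveLaw a b c d X X' fL fR w v K B) : ContinuousOn X (Ioo a b) :=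
  fun _ ht => (h.continuousAt_X ht).continuousWithinAt

lemma fL_continuousAt (h : CurveLaw a b c d X X' fL fR w v K B) {t x : ℝ} (ht : t ∈ Ioo a b)
    (hx : x ∈ Ioo c d) : ContinuousAt (fun q : ℝ × ℝ => fL q.1 q.2) (t, x) :=
  h.fL_cont.continuousAt ((isOpen_Ioo.prod isOpen_Ioo).mem_nhds ⟨ht, hx⟩)

lemma fR_continuousAt (h : CurveLaw a b c d X X' fL fR w v K B) {t x : ℝ} (ht : t ∈ Ioo a b)
    (hx : x ∈ Ioo c d) : ContinuousAt (fun q : ℝ × ℝ => fR q.1 q.2) (t, x) :=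
  h.fR_cont.continuousAt ((isOpen_Ioo.prod isOpen_Ioo).mem_nhds ⟨ht, hx⟩)

lemma fL_slice (h : CurveLaw a b c d X X' fL fR w v K B) {t x : ℝ} (ht : t ∈ Ioo a b)
    (hx : x ∈ Ioo c d) : ContinuousAt (fL t) x :=
  ContinuousAt.comp (f := fun y => (t, y)) (h.fL_continuousAt ht hx) (by fun_prop)

lemma fR_slice (h : CurveLaw a b c d X X' fL fR w v K B) {t x : ℝ} (ht : t ∈ Ioo a b)
    (hx : x ∈ Ioo c d) : ContinuousAt (fR t) x :=
  ContinuousAt.comp (f := fun y => (t, y)) (h.fR_continuousAt ht hx) (by fun_prop)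

lemma v_slice (h : CurveLaw a b c d X X' fL fR w v K B) {t x : ℝ} (ht : t ∈ Ioo a b)
    (hx : x ∈ Ioo c d) (hxX : x ≠ X t) : ContinuousAt (v t) x :=
  ContinuousAt.comp (f := fun y => (t, y)) (h.v_cont t ht x hx hxX) (by fun_prop)

lemma B_nonneg (h : CurveLaw a b c d X X' fL fR w v K B) {t : ℝ} (ht : t ∈ Ioo a b) : 0 ≤ B :=
  (abs_nonneg _).trans (h.w_bdd t ht)

lemma K_nonneg (h : CurveLaw a b c d X X' fL fR w v K B) {t : ℝ} (ht : t ∈ Ioo a b) : 0 ≤ K := by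
  have hX := h.X_mem t ht
  obtain ⟨y, hy1, hy2⟩ := exists_between hX.2
  have := (abs_nonneg _).trans (h.fL_lip t ht y ⟨hX.1.trans hy1, hy2⟩ (X t) hX)
  exact nonneg_of_mul_nonneg_left this (abs_pos.2 (sub_pos.2 hy1).ne')

lemma abs_glued_le (h : CurveLaw a b c d X X' fL fR w v K B) {t x : ℝ} (ht : t ∈ Ioo a b)
    (hx : x ∈ Ioo c d) : |glued X fL fR t x| ≤ B := by
  unfold glued
  split_ifs
  exacts [h.fL_bdd t ht x hx, h.fR_bdd t ht x hx]

lemma abs_outerIncrement_le (h : CurveLaw a b c d X X' fL fR w v K B) {t x₁ x₂ : ℝ}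
    (ht : t ∈ Ioo a b) (hx₁ : x₁ ∈ Ioo c d) (hx₂ : x₂ ∈ Ioo c d) :
    |outerIncrement X fL fR x₁ x₂ t| ≤ 2 * B := by
  have h1 := h.abs_glued_le ht hx₂
  have h2 : |if x₁ ≤ X t then fL t x₁ else fR t x₁| ≤ B := by
    split_ifs
    exacts [h.fL_bdd t ht _ hx₁, h.fR_bdd t ht _ hx₁]
  unfold outerIncrement
  exact (abs_sub _ _).trans (by linarith)

lemma glued_tendsto_left (h : CurveLaw a b c d X X' fL fR w v K B) {t x : ℝ} (ht : t ∈ Ioo a b)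
    (hx : x ∈ Ioo c d) :
    Tendsto (glued X fL fR t) (𝓝[<] x) (𝓝 (if x ≤ X t then fL t x else fR t x)) := by
  split_ifs with hX
  · refine ((h.fL_slice ht hx).tendsto.mono_left nhdsWithin_le_nhds).congr' ?_
    filter_upwards [self_mem_nhdsWithin] with y hy
    rw [glued, if_pos (lt_of_lt_of_le hy hX)]
  · refine ((h.fR_slice ht hx).tendsto.mono_left nhdsWithin_le_nhds).congr' ?_
    filter_upwards [nhdsWithin_le_nhds (lt_mem_nhds (not_le.1 hX))] with y hy
    rw [glued, if_neg (not_lt.2 (le_of_lt hy))]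

lemma glued_tendsto_right (h : CurveLaw a b c d X X' fL fR w v K B) {t x : ℝ} (ht : t ∈ Ioo a b)
    (hx : x ∈ Ioo c d) :
    Tendsto (glued X fL fR t) (𝓝[>] x) (𝓝 (glued X fL fR t x)) := by
  by_cases hX : x < X t
  · rw [glued, if_pos hX]
    refine ((h.fL_slice ht hx).tendsto.mono_left nhdsWithin_le_nhds).congr' ?_
    filter_upwards [nhdsWithin_le_nhds (gt_mem_nhds hX)] with y hy
    rw [glued, if_pos hy]
  · rw [glued, if_neg hX]
    refine ((h.fR_slice ht hx).tendsto.mono_left nhdsWithin_le_nhds).congr' ?_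
    filter_upwards [self_mem_nhdsWithin] with y hy
    rw [glued, if_neg (not_lt.2 ((not_lt.1 hX).trans (le_of_lt hy)))]

end CurveLaw

lemma restrict_prod_restrict_volume (s t : Set ℝ) :
    ((volume : Measure ℝ).restrict s).prod ((volume : Measure ℝ).restrict t) =
      (volume : Measure (ℝ × ℝ)).restrict (s ×ˢ t) := by
  rw [Measure.prod_restrict, Measure.volume_eq_prod]

lemma glued_integrableOn {a b c d B : ℝ} {X : ℝ → ℝ} {fL fR : ℝ → ℝ → ℝ}
    (hX : ContinuousOn X (Ioo a b))
    (hL : ContinuousOn (fun q : ℝ × ℝ => fL q.1 q.2) (Ioo a b ×ˢ Ioo c d))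
    (hR : ContinuousOn (fun q : ℝ × ℝ => fR q.1 q.2) (Ioo a b ×ˢ Ioo c d))
    (hB : ∀ t ∈ Ioo a b, ∀ x ∈ Ioo c d, |glued X fL fR t x| ≤ B) :
    IntegrableOn (fun q : ℝ × ℝ => glued X fL fR q.1 q.2) (Ioo a b ×ˢ Ioo c d) := by
  classical
  have hU : MeasurableSet (Ioo a b ×ˢ Ioo c d) := measurableSet_Ioo.prod measurableSet_Ioo
  have hUo : IsOpen (Ioo a b ×ˢ Ioo c d) := isOpen_Ioo.prod isOpen_Ioo
  have hA : IsOpen ((Ioo a b ×ˢ Ioo c d) ∩ {q : ℝ × ℝ | 0 < X q.1 - q.2}) := by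
    have hc : ContinuousOn (fun q : ℝ × ℝ => X q.1 - q.2) (Ioo a b ×ˢ Ioo c d) :=
      (hX.comp continuousOn_fst fun q hq => hq.1).sub continuousOn_snd
    exact hc.isOpen_inter_preimage hUo isOpen_Ioi
  have hmeas : AEStronglyMeasurable (fun q : ℝ × ℝ => glued X fL fR q.1 q.2)
      (volume.restrict (Ioo a b ×ˢ Ioo c d)) := by
    refine (AEStronglyMeasurable.piecewise hA.measurableSet
      (hL.aestronglyMeasurable hU).restrict
      (hR.aestronglyMeasurable hU).restrict).congr ?_
    filter_upwards [ae_restrict_mem hU] with q hq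
    by_cases hq2 : q.2 < X q.1
    · have hmem : q ∈ (Ioo a b ×ˢ Ioo c d) ∩ {q : ℝ × ℝ | 0 < X q.1 - q.2} :=
        ⟨hq, by simpa using hq2⟩
      rw [piecewise_eq_of_mem _ _ _ hmem, glued, if_pos hq2]
    · rw [piecewise_eq_of_notMem _ _ _ (fun hh => hq2 (by simpa using hh.2)), glued, if_neg hq2]
  have hfin : volume (Ioo a b ×ˢ Ioo c d) ≠ ⊤ := by
    rw [Measure.volume_eq_prod, Measure.prod_prod]
    simp [Real.volume_Ioo, ENNReal.mul_eq_top]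
  refine IntegrableOn.of_bound hfin.lt_top hmeas B ?_
  filter_upwards [ae_restrict_mem hU] with q hq
  exact hB _ hq.1 _ hq.2

lemma integrable_integral_mul {a b c d : ℝ} {g : ℝ → ℝ → ℝ} {β : ℝ → ℝ} (hβ : Continuous β)
    (hg : IntegrableOn (fun q : ℝ × ℝ => g q.1 q.2) (Ioo a b ×ˢ Ioo c d)) :
    IntegrableOn (fun t => ∫ x in Ioo c d, g t x * β x) (Ioo a b) := by
  obtain ⟨C, hC⟩ := isCompact_Icc.exists_bound_of_continuousOn (hβ.continuousOn (s := Icc c d))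
  have h2 : IntegrableOn (fun q : ℝ × ℝ => g q.1 q.2 * β q.2) (Ioo a b ×ˢ Ioo c d) := by
    refine Integrable.mul_bdd (c := C) hg (by fun_prop) ?_
    filter_upwards [ae_restrict_mem (measurableSet_Ioo.prod measurableSet_Ioo)] with q hq
    exact hC _ (Ioo_subset_Icc_self hq.2)
  rw [IntegrableOn, ← restrict_prod_restrict_volume] at h2
  exact h2.integral_prod_left

lemma integrable_slice_ae {a b c d : ℝ} {g : ℝ → ℝ → ℝ}
    (hg : IntegrableOn (fun q : ℝ × ℝ => g q.1 q.2) (Ioo a b ×ˢ Ioo c d)) :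
    ∀ᵐ t ∂(volume.restrict (Ioo a b)), IntegrableOn (g t) (Ioo c d) := by
  rw [IntegrableOn, ← restrict_prod_restrict_volume] at hg
  exact hg.prod_right_ae

lemma integrable_integral_abs {a b c d : ℝ} {g : ℝ → ℝ → ℝ}
    (hg : IntegrableOn (fun q : ℝ × ℝ => g q.1 q.2) (Ioo a b ×ˢ Ioo c d)) :
    IntegrableOn (fun t => ∫ x in Ioo c d, |g t x|) (Ioo a b) := by
  have h2 := hg.abs
  rw [← restrict_prod_restrict_volume] at h2
  exact h2.integral_prod_left

lemma exists_bound_of_hasCompactSupport {α : ℝ → ℝ} (h1 : Continuous α)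
    (h2 : HasCompactSupport α) : ∃ C, 0 ≤ C ∧ ∀ t, |α t| ≤ C := by
  obtain ⟨C, hC⟩ := h2.exists_bound_of_continuous h1
  exact ⟨C, (abs_nonneg _).trans (hC 0), hC⟩

namespace CurveLaw

variable {a b c d : ℝ} {X X' : ℝ → ℝ} {fL fR : ℝ → ℝ → ℝ} {w : ℝ → ℝ} {v : ℝ → ℝ → ℝ} {K B : ℝ}

lemma glued_int (h : CurveLaw a b c d X X' fL fR w v K B) :
    IntegrableOn (fun q : ℝ × ℝ => glued X fL fR q.1 q.2) (Ioo a b ×ˢ Ioo c d) :=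
  glued_integrableOn h.continuousOn_X h.fL_cont h.fR_cont fun _ ht _ hx => h.abs_glued_le ht hx

lemma tendsto_integral_glued (h : CurveLaw a b c d X X' fL fR w v K B) {x₁ x₂ : ℝ}
    (hx₁ : x₁ ∈ Ioo c d) (hx₂ : x₂ ∈ Ioo c d) :
    ∀ᵐ t ∂(volume.restrict (Ioo a b)),
      Tendsto (fun n : ℕ => ∫ x in Ioo c d, glued X fL fR t x * deriv (smoothCutoff n x₁ x₂) x)
        atTop (𝓝 (-outerIncrement X fL fR x₁ x₂ t)) := by
  filter_upwards [ae_restrict_mem measurableSet_Ioo, integrable_slice_ae h.glued_int] with t ht hi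
  rw [outerIncrement, neg_sub]
  exact tendsto_integral_mul_deriv_smoothCutoff hx₁ hx₂ hi (h.glued_tendsto_left ht hx₁)
    (h.glued_tendsto_right ht hx₂)

lemma outerIncrement_integrableOn (h : CurveLaw a b c d X X' fL fR w v K B) {x₁ x₂ : ℝ}
    (hx₁ : x₁ ∈ Ioo c d) (hx₂ : x₂ ∈ Ioo c d) :
    IntegrableOn (outerIncrement X fL fR x₁ x₂) (Ioo a b) := by
  have hm := aestronglyMeasurable_of_tendsto_ae (μ := volume.restrict (Ioo a b)) atTop
    (fun n => (integrable_integral_mul (smoothCutoff_continuous_deriv n x₁ x₂)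
      h.glued_int).aestronglyMeasurable) (h.tendsto_integral_glued hx₁ hx₂)
  have hm' : AEStronglyMeasurable (outerIncrement X fL fR x₁ x₂) (volume.restrict (Ioo a b)) :=
    hm.neg.congr (Eventually.of_forall fun t => neg_neg _)
  refine IntegrableOn.of_bound (by simp) hm' (2 * B) ?_
  filter_upwards [ae_restrict_mem measurableSet_Ioo] with t ht
  exact h.abs_outerIncrement_le ht hx₁ hx₂

lemma weak_box (h : CurveLaw a b c d X X' fL fR w v K B) {x₁ x₂ : ℝ}
    (hx₁ : x₁ ∈ Ioo c d) (hx₂ : x₂ ∈ Ioo c d) (h12 : x₁ ≤ x₂) {α : ℝ → ℝ}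
    (hα : ContDiff ℝ (⊤ : ℕ∞) α) (hαc : HasCompactSupport α) (hαs : tsupport α ⊆ Ioo a b) :
    (∫ t in Ioo a b, deriv α t * ∫ x in Icc x₁ x₂, v t x) +
      (∫ t in Ioo a b, w t * (deriv α t * (Icc x₁ x₂).indicator 1 (X t))) =
      ∫ t in Ioo a b, α t * -outerIncrement X fL fR x₁ x₂ t := by
  have hα' : Continuous (deriv α) := (hα.of_le (m := 1) (by simp)).continuous_deriv le_rfl
  obtain ⟨C, hC0, hC⟩ := exists_bound_of_hasCompactSupport hα.continuous hαc
  obtain ⟨C', hC0', hC'⟩ := exists_bound_of_hasCompactSupport hα' hαc.deriv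
  have l1 : Tendsto (fun n : ℕ => ∫ t in Ioo a b, deriv α t *
      ∫ x in Ioo c d, v t x * smoothCutoff n x₁ x₂ x) atTop
      (𝓝 (∫ t in Ioo a b, deriv α t * ∫ x in Icc x₁ x₂, v t x)) := by
    refine tendsto_integral_of_dominated_convergence (fun t => C' * ∫ x in Ioo c d, |v t x|)
      (fun n => hα'.aestronglyMeasurable.mul (integrable_integral_mul
        (smoothCutoff_continuous n x₁ x₂) h.v_int).aestronglyMeasurable)
      ((integrable_integral_abs h.v_int).const_mul _) (fun n => ?_) ?_
    · filter_upwards [integrable_slice_ae h.v_int] with t hi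
      rw [norm_mul]
      refine mul_le_mul (hC' t) ?_ (norm_nonneg _) hC0'
      refine norm_integral_le_of_norm_le hi.abs (Eventually.of_forall fun x => ?_)
      rw [Real.norm_eq_abs, abs_mul]
      exact mul_le_of_le_one_right (abs_nonneg _) (abs_smoothCutoff_le_one _ _ _ _)
    · filter_upwards [integrable_slice_ae h.v_int] with t hi
      exact (tendsto_integral_mul_smoothCutoff hx₁.1 h12 hx₂.2 hi).const_mul _
  have l2 : Tendsto (fun n : ℕ => ∫ t in Ioo a b, w t * (deriv α t * smoothCutoff n x₁ x₂ (X t)))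
      atTop (𝓝 (∫ t in Ioo a b, w t * (deriv α t * (Icc x₁ x₂).indicator 1 (X t)))) := by
    refine tendsto_integral_of_dominated_convergence (fun t => B * C')
      (fun n => ?_) (integrable_const _) (fun n => ?_) ?_
    · exact (h.w_cont.mul (hα'.continuousOn.mul ((smoothCutoff_continuous n x₁ x₂).comp_continuousOn
        h.continuousOn_X))).aestronglyMeasurable measurableSet_Ioo
    · filter_upwards [ae_restrict_mem measurableSet_Ioo] with t ht
      rw [norm_mul, norm_mul]
      refine mul_le_mul (h.w_bdd t ht) ?_ (by positivity) (h.B_nonneg ht)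
      exact (mul_le_of_le_one_right (norm_nonneg _) (abs_smoothCutoff_le_one _ _ _ _)).trans (hC' t)
    · exact Eventually.of_forall fun t =>
        ((tendsto_smoothCutoff h12 (X t)).const_mul _).const_mul _
  have l3 : Tendsto (fun n : ℕ => ∫ t in Ioo a b, α t *
      ∫ x in Ioo c d, glued X fL fR t x * deriv (smoothCutoff n x₁ x₂) x) atTop
      (𝓝 (∫ t in Ioo a b, α t * -outerIncrement X fL fR x₁ x₂ t)) := by
    refine tendsto_integral_filter_of_dominated_convergence (fun t => C * (B * 2))
      (Eventually.of_forall fun n => hα.continuous.aestronglyMeasurable.mul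
        (integrable_integral_mul (smoothCutoff_continuous_deriv n x₁ x₂)
          h.glued_int).aestronglyMeasurable) ?_ (integrable_const _) ?_
    · filter_upwards [eventually_integral_abs_deriv_smoothCutoff_le hx₁ hx₂] with n hn
      filter_upwards [ae_restrict_mem measurableSet_Ioo] with t ht
      rw [norm_mul]
      refine mul_le_mul (hC t) ?_ (norm_nonneg _) hC0
      refine (norm_integral_le_of_norm_le (g := fun x => B * |deriv (smoothCutoff n x₁ x₂) x|)
        ?_ ?_).trans ?_
      · exact ((smoothCutoff_continuous_deriv n x₁ x₂).abs.continuousOn.integrableOn_Icc.mono_set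
          Ioo_subset_Icc_self).const_mul _
      · filter_upwards [ae_restrict_mem measurableSet_Ioo] with x hx
        rw [norm_mul]
        exact mul_le_mul_of_nonneg_right (h.abs_glued_le ht hx) (norm_nonneg _)
      · rw [integral_const_mul]
        exact mul_le_mul_of_nonneg_left hn (h.B_nonneg ht)
    · filter_upwards [h.tendsto_integral_glued hx₁ hx₂] with t ht
      exact ht.const_mul _
  refine tendsto_nhds_unique ((l1.add l2).congr' ?_) l3
  filter_upwards [eventually_smoothCutoff_tsupport hx₁.1 h12 hx₂.2] with n hn
  exact h.weak α _ hα (smoothCutoff_contDiff n x₁ x₂) hαc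
    (smoothCutoff_hasCompactSupport hn.1 h12) hαs hn.2

/-- The integral form of the conservation law on the box `[t₁, t₂] × [x₁, x₂]`. -/
lemma box_balance (h : CurveLaw a b c d X X' fL fR w v K B) {x₁ x₂ t₁ t₂ : ℝ}
    (hx₁ : x₁ ∈ Ioo c d) (hx₂ : x₂ ∈ Ioo c d) (h12 : x₁ ≤ x₂)
    (ht₁ : t₁ ∈ Ioo a b) (ht₂ : t₂ ∈ Ioo a b) (ht12 : t₁ ≤ t₂)
    (hv₁ : ContinuousAt (fun t => ∫ x in Icc x₁ x₂, v t x) t₁)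
    (hv₂ : ContinuousAt (fun t => ∫ x in Icc x₁ x₂, v t x) t₂)
    (hX₁ : X t₁ ≠ x₁ ∧ X t₁ ≠ x₂) (hX₂ : X t₂ ≠ x₁ ∧ X t₂ ≠ x₂) :
    ((∫ x in Icc x₁ x₂, v t₂ x) - ∫ x in Icc x₁ x₂, v t₁ x) +
      (w t₂ * (Icc x₁ x₂).indicator 1 (X t₂) - w t₁ * (Icc x₁ x₂).indicator 1 (X t₁)) =
      ∫ t in t₁..t₂, outerIncrement X fL fR x₁ x₂ t := by
  have hind : ∀ t ∈ Ioo a b, X t ≠ x₁ ∧ X t ≠ x₂ →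
      ContinuousAt (fun t => w t * (Icc x₁ x₂).indicator 1 (X t)) t := by
    intro t ht hXt
    refine (h.w_cont.continuousAt (isOpen_Ioo.mem_nhds ht)).mul ?_
    have hc : ContinuousAt ((Icc x₁ x₂).indicator (1 : ℝ → ℝ)) (X t) := by
      refine continuousOn_const.continuousAt_indicator ?_
      rw [frontier_Icc h12]
      simpa using hXt
    exact hc.comp (h.continuousAt_X ht)
  have hvi : IntegrableOn (fun t => ∫ x in Icc x₁ x₂, v t x) (Ioo a b) := by
    have h2 := h.v_int.mono_set (prod_mono (Subset.refl (Ioo a b)) (Icc_subset_Ioo hx₁.1 hx₂.2))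
    rw [IntegrableOn, ← restrict_prod_restrict_volume] at h2
    exact h2.integral_prod_left
  have hwi : IntegrableOn (fun t => w t * (Icc x₁ x₂).indicator 1 (X t)) (Ioo a b) := by
    refine IntegrableOn.of_bound (C := B) (by simp) ?_ ?_
    · refine (h.w_cont.aestronglyMeasurable measurableSet_Ioo).mul ?_
      have hXm : AEMeasurable X (volume.restrict (Ioo a b)) :=
        h.continuousOn_X.aemeasurable measurableSet_Ioo
      have : Measurable ((Icc x₁ x₂).indicator (1 : ℝ → ℝ)) :=
        measurable_one.indicator measurableSet_Icc
      exact (this.comp_aemeasurable hXm).aestronglyMeasurable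
    · filter_upwards [ae_restrict_mem measurableSet_Ioo] with t ht
      rw [norm_mul]
      refine (mul_le_of_le_one_right (norm_nonneg _) ?_).trans (h.w_bdd t ht)
      by_cases hX : X t ∈ Icc x₁ x₂ <;> simp [hX]
  have l1 := tendsto_integral_mul_deriv_smoothCutoff ht₁ ht₂ hvi
    (hv₁.tendsto.mono_left nhdsWithin_le_nhds) (hv₂.tendsto.mono_left nhdsWithin_le_nhds)
  have l2 := tendsto_integral_mul_deriv_smoothCutoff ht₁ ht₂ hwi
    ((hind t₁ ht₁ hX₁).tendsto.mono_left nhdsWithin_le_nhds)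
    ((hind t₂ ht₂ hX₂).tendsto.mono_left nhdsWithin_le_nhds)
  have l3 := tendsto_integral_mul_smoothCutoff ht₁.1 ht12 ht₂.2
    (h.outerIncrement_integrableOn hx₁ hx₂)
  rw [intervalIntegral.integral_of_le ht12, ← integral_Icc_eq_integral_Ioc]
  have := tendsto_nhds_unique ((l1.add l2).congr' ?_) l3.neg
  · linarith
  filter_upwards [eventually_smoothCutoff_tsupport ht₁.1 ht12 ht₂.2] with n hn
  have hw := h.weak_box hx₁ hx₂ h12 (smoothCutoff_contDiff n t₁ t₂)
    (smoothCutoff_hasCompactSupport hn.1 ht12) hn.2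
  rw [← integral_neg]
  convert hw using 1
  · congr 2
    · ext t; ring
    · ext t; ring
  · congr 1
    ext t; ring

end CurveLaw

/-- The jump of the glued function across the curve. -/
noncomputable def jump (X : ℝ → ℝ) (fL fR : ℝ → ℝ → ℝ) (t : ℝ) : ℝ :=
  fR t (X t) - fL t (X t)

lemma abs_setIntegral_sub_le {f : ℝ → ℝ} {A ε x₁ x₂ z : ℝ} (h12 : x₁ ≤ x₂)
    (hf : AEStronglyMeasurable f (volume.restrict (Icc x₁ x₂)))
    (hb : ∀ x ∈ Icc x₁ x₂, x ≠ z → |f x - A| ≤ ε) :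
    |(∫ x in Icc x₁ x₂, f x) - A * (x₂ - x₁)| ≤ ε * (x₂ - x₁) := by
  have hae : ∀ᵐ x ∂(volume.restrict (Icc x₁ x₂)), |f x - A| ≤ ε := by
    filter_upwards [ae_restrict_mem measurableSet_Icc,
      ae_restrict_of_ae (Measure.ae_ne volume z)] with x hx hz
    exact hb x hx hz
  have hi : IntegrableOn (fun x => f x - A) (Icc x₁ x₂) :=
    IntegrableOn.of_bound (by simp) (hf.sub aestronglyMeasurable_const) ε hae
  have hfi : IntegrableOn f (Icc x₁ x₂) := by
    simpa only [Pi.add_def, sub_add_cancel] using hi.add (integrable_const A)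
  have hc : ∀ e : ℝ, ∫ _ in Icc x₁ x₂, e = e * (x₂ - x₁) := fun e => by
    rw [setIntegral_const, Real.volume_real_Icc_of_le h12, smul_eq_mul, mul_comm]
  rw [← hc A, ← integral_sub hfi (integrable_const A), ← hc ε]
  rw [← Real.norm_eq_abs]
  exact norm_integral_le_of_norm_le (integrable_const ε) hae

namespace CurveLaw

variable {a b c d : ℝ} {X X' : ℝ → ℝ} {fL fR : ℝ → ℝ → ℝ} {w : ℝ → ℝ} {v : ℝ → ℝ → ℝ} {K B : ℝ}

lemma v_slice_measurable (h : CurveLaw a b c d X X' fL fR w v K B) {t x₁ x₂ : ℝ}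
    (ht : t ∈ Ioo a b) (hx₁ : x₁ ∈ Ioo c d) (hx₂ : x₂ ∈ Ioo c d) :
    AEStronglyMeasurable (v t) (volume.restrict (Icc x₁ x₂)) := by
  have hc : ContinuousOn (v t) (Ioo c d \ {X t}) := fun x hx =>
    (h.v_slice ht hx.1 hx.2).continuousWithinAt
  have hm := hc.aestronglyMeasurable (μ := volume)
    (measurableSet_Ioo.diff (measurableSet_singleton _))
  rw [Measure.restrict_congr_set (sdiff_null_ae_eq_self (by simp))] at hm
  exact hm.mono_set (Icc_subset_Ioo hx₁.1 hx₂.2)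

lemma continuousAt_integral (h : CurveLaw a b c d X X' fL fR w v K B) {t x₁ x₂ : ℝ}
    (ht : t ∈ Ioo a b) (hx₁ : x₁ ∈ Ioo c d) (hx₂ : x₂ ∈ Ioo c d) {g : ℝ → ℝ}
    (hg : IntegrableOn g (Icc x₁ x₂))
    (hb : ∀ᶠ s in 𝓝 t, ∀ x ∈ Icc x₁ x₂, x ≠ X s → |v s x| ≤ g x) :
    ContinuousAt (fun t => ∫ x in Icc x₁ x₂, v t x) t := by
  refine continuousAt_of_dominated (bound := g) ?_ ?_ hg ?_
  · filter_upwards [isOpen_Ioo.mem_nhds ht] with s hs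
    exact h.v_slice_measurable hs hx₁ hx₂
  · filter_upwards [hb] with s hs
    filter_upwards [ae_restrict_mem measurableSet_Icc,
      ae_restrict_of_ae (Measure.ae_ne volume (X s))] with x hx hz
    exact hs x hx hz
  · filter_upwards [ae_restrict_mem measurableSet_Icc,
      ae_restrict_of_ae (Measure.ae_ne volume (X t))] with x hx hz
    exact ContinuousAt.comp (f := fun s => (s, x))
      (h.v_cont t ht x (Icc_subset_Ioo hx₁.1 hx₂.2 hx) hz) (by fun_prop)

lemma continuousAt_integral_of_notMem (h : CurveLaw a b c d X X' fL fR w v K B) {t x₁ x₂ : ℝ}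
    (ht : t ∈ Ioo a b) (hx₁ : x₁ ∈ Ioo c d) (hx₂ : x₂ ∈ Ioo c d) (hX : X t ∉ Icc x₁ x₂) :
    ContinuousAt (fun t => ∫ x in Icc x₁ x₂, v t x) t := by
  have hne : ∀ x ∈ Icc x₁ x₂, x ≠ X t := fun x hx hxX => hX (hxX ▸ hx)
  have hc : ContinuousOn (v t) (Icc x₁ x₂) := fun x hx =>
    (h.v_slice ht (Icc_subset_Ioo hx₁.1 hx₂.2 hx) (hne x hx)).continuousWithinAt
  obtain ⟨C, hC⟩ := isCompact_Icc.exists_bound_of_continuousOn hc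
  refine h.continuousAt_integral ht hx₁ hx₂ (g := fun _ => C + 1)
    (integrable_const _) ?_
  have := isCompact_Icc.eventually_forall_of_forall_eventually (x₀ := t) (K := Icc x₁ x₂)
    (P := fun s x => |v s x| < C + 1) fun x hx =>
      (h.v_cont t ht x (Icc_subset_Ioo hx₁.1 hx₂.2 hx) (hne x hx)).abs.eventually
        (gt_mem_nhds (by simpa using (hC x hx).trans_lt (lt_add_one C)))
  filter_upwards [this] with s hs x hx _
  exact (hs x hx).le

lemma abs_outerIncrement_sub_jump_le (h : CurveLaw a b c d X X' fL fR w v K B) {t x₁ x₂ : ℝ}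
    (ht : t ∈ Ioo a b) (hx₁ : x₁ ∈ Ioo c d) (hx₂ : x₂ ∈ Ioo c d) (hX : X t ∈ Icc x₁ x₂) :
    |outerIncrement X fL fR x₁ x₂ t - jump X fL fR t| ≤ 2 * K * (x₂ - x₁) := by
  have hK := h.K_nonneg ht
  rw [outerIncrement, jump, glued, if_neg (not_lt.2 hX.2), if_pos hX.1]
  have h1 := h.fR_lip t ht x₂ hx₂ (X t) (h.X_mem t ht)
  have h2 := h.fL_lip t ht x₁ hx₁ (X t) (h.X_mem t ht)
  rw [abs_of_nonneg (sub_nonneg.2 hX.2)] at h1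
  rw [abs_of_nonpos (sub_nonpos.2 hX.1)] at h2
  have := mul_nonneg hK (sub_nonneg.2 (hX.1.trans hX.2))
  rw [abs_le] at *
  constructor <;> nlinarith

lemma abs_outerIncrement_le_of_notMem (h : CurveLaw a b c d X X' fL fR w v K B) {t x₁ x₂ : ℝ}
    (ht : t ∈ Ioo a b) (hx₁ : x₁ ∈ Ioo c d) (hx₂ : x₂ ∈ Ioo c d) (h12 : x₁ ≤ x₂)
    (hX : X t ∉ Icc x₁ x₂) : |outerIncrement X fL fR x₁ x₂ t| ≤ 2 * K * (x₂ - x₁) := by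
  have hK := mul_nonneg (h.K_nonneg ht) (sub_nonneg.2 h12)
  have e : |x₂ - x₁| = x₂ - x₁ := abs_of_nonneg (sub_nonneg.2 h12)
  rcases lt_or_ge (X t) x₁ with hlt | hge
  · rw [outerIncrement, glued, if_neg (by linarith), if_neg (by linarith)]
    have := h.fR_lip t ht x₂ hx₂ x₁ hx₁
    rw [e] at this
    linarith
  · have hlt : x₂ < X t := by
      by_contra! hh
      exact hX ⟨hge, hh⟩
    rw [outerIncrement, glued, if_pos hlt, if_pos hge]
    have := h.fL_lip t ht x₂ hx₂ x₁ hx₁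
    rw [e] at this
    linarith

lemma outerIncrement_intervalIntegrable (h : CurveLaw a b c d X X' fL fR w v K B)
    {x₁ x₂ t₁ t₂ : ℝ} (hx₁ : x₁ ∈ Ioo c d) (hx₂ : x₂ ∈ Ioo c d)
    (ht₁ : t₁ ∈ Ioo a b) (ht₂ : t₂ ∈ Ioo a b) :
    IntervalIntegrable (outerIncrement X fL fR x₁ x₂) volume t₁ t₂ := by
  have hs : uIcc t₁ t₂ ⊆ Ioo a b := ordConnected_Ioo.uIcc_subset ht₁ ht₂
  exact ((h.outerIncrement_integrableOn hx₁ hx₂).mono_set hs).intervalIntegrable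

/-- The balance on a box whose two time edges avoid the curve, with `v` nearly constant there. -/
lemma box_balance_of_notMem (h : CurveLaw a b c d X X' fL fR w v K B)
    {x₁ x₂ t₁ t₂ A₁ A₂ ε z : ℝ}
    (hx₁ : x₁ ∈ Ioo c d) (hx₂ : x₂ ∈ Ioo c d) (h12 : x₁ ≤ x₂)
    (ht₁ : t₁ ∈ Ioo a b) (ht₂ : t₂ ∈ Ioo a b) (ht12 : t₁ ≤ t₂)
    (hX₁ : X t₁ ∉ Icc x₁ x₂) (hX₂ : X t₂ ∉ Icc x₁ x₂)
    (hA₁ : ∀ x ∈ Icc x₁ x₂, x ≠ z → |v t₁ x - A₁| ≤ ε)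
    (hA₂ : ∀ x ∈ Icc x₁ x₂, x ≠ z → |v t₂ x - A₂| ≤ ε) :
    |(A₂ - A₁) * (x₂ - x₁) - ∫ t in t₁..t₂, outerIncrement X fL fR x₁ x₂ t|
      ≤ 2 * ε * (x₂ - x₁) := by
  have hne : ∀ t, X t ∉ Icc x₁ x₂ → X t ≠ x₁ ∧ X t ≠ x₂ := fun t ht =>
    ⟨fun e => ht (by rw [e]; exact left_mem_Icc.2 h12),
      fun e => ht (by rw [e]; exact right_mem_Icc.2 h12)⟩
  have hb := h.box_balance hx₁ hx₂ h12 ht₁ ht₂ ht12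
    (h.continuousAt_integral_of_notMem ht₁ hx₁ hx₂ hX₁)
    (h.continuousAt_integral_of_notMem ht₂ hx₁ hx₂ hX₂) (hne _ hX₁) (hne _ hX₂)
  rw [indicator_of_notMem hX₁, indicator_of_notMem hX₂] at hb
  have h1 := abs_setIntegral_sub_le h12 (h.v_slice_measurable ht₁ hx₁ hx₂) hA₁
  have h2 := abs_setIntegral_sub_le h12 (h.v_slice_measurable ht₂ hx₁ hx₂) hA₂
  rw [← hb]
  rw [abs_le] at *
  constructor <;> linarith

/-- Off the curve, `v` is Lipschitz in time. -/
lemma abs_sub_le_of_forall_ne (h : CurveLaw a b c d X X' fL fR w v K B) {t₁ t₂ x : ℝ}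
    (ht₁ : t₁ ∈ Ioo a b) (ht₂ : t₂ ∈ Ioo a b) (ht12 : t₁ ≤ t₂) (hx : x ∈ Ioo c d)
    (hX : ∀ s ∈ Icc t₁ t₂, X s ≠ x) : |v t₂ x - v t₁ x| ≤ 2 * K * (t₂ - t₁) := by
  refine le_of_forall_pos_le_add fun ε hε => ?_
  have hsub : Icc t₁ t₂ ⊆ Ioo a b := Icc_subset_Ioo ht₁.1 ht₂.2
  have e1 : ∀ᶠ y in 𝓝 x, y ∉ X '' Icc t₁ t₂ :=
    (isCompact_Icc.image_of_continuousOn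
      (h.continuousOn_X.mono hsub)).isClosed.isOpen_compl.mem_nhds
      (by rintro ⟨s, hs, rfl⟩; exact hX s hs rfl)
  have e2 : ∀ t ∈ Icc t₁ t₂, ∀ᶠ y in 𝓝 x, |v t y - v t x| < ε / 2 := fun t ht =>
    Metric.continuousAt_iff'.1 (h.v_slice (hsub ht) hx (hX t ht).symm) _ (half_pos hε)
  obtain ⟨δ, hδ, hball⟩ := Metric.eventually_nhds_iff.1 (e1.and ((e2 t₁ (left_mem_Icc.2 ht12)).and
    ((e2 t₂ (right_mem_Icc.2 ht12)).and (isOpen_Ioo.mem_nhds hx))))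
  have hI : ∀ y ∈ Icc (x - δ / 2) (x + δ / 2), dist y x < δ := fun y hy => by
    rw [Real.dist_eq, abs_lt]
    constructor <;> linarith [hy.1, hy.2]
  have h12 : x - δ / 2 ≤ x + δ / 2 := by linarith
  have hx₁ := (hball (hI _ (left_mem_Icc.2 h12))).2.2.2
  have hx₂ := (hball (hI _ (right_mem_Icc.2 h12))).2.2.2
  have hnot : ∀ s ∈ Icc t₁ t₂, X s ∉ Icc (x - δ / 2) (x + δ / 2) := fun s hs hXs =>
    (hball (hI _ hXs)).1 ⟨s, hs, rfl⟩
  have hb := h.box_balance_of_notMem (z := x - δ) hx₁ hx₂ h12 ht₁ ht₂ ht12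
    (hnot _ (left_mem_Icc.2 ht12)) (hnot _ (right_mem_Icc.2 ht12))
    (fun y hy _ => (hball (hI y hy)).2.1.le) (fun y hy _ => (hball (hI y hy)).2.2.1.le)
  have hflux : |∫ t in t₁..t₂, outerIncrement X fL fR (x - δ / 2) (x + δ / 2) t| ≤
      2 * K * (x + δ / 2 - (x - δ / 2)) * |t₂ - t₁| := by
    rw [← Real.norm_eq_abs]
    refine intervalIntegral.norm_integral_le_of_norm_le_const fun t ht => ?_
    rw [uIoc_of_le ht12] at ht
    have ht' := Ioc_subset_Icc_self ht
    exact h.abs_outerIncrement_le_of_notMem (hsub ht') hx₁ hx₂ h12 (hnot t ht')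
  rw [abs_of_nonneg (sub_nonneg.2 ht12)] at hflux
  have e : x + δ / 2 - (x - δ / 2) = δ := by ring
  rw [e] at hb hflux
  have : |(v t₂ x - v t₁ x) * δ| ≤ (2 * K * (t₂ - t₁) + ε) * δ := by
    rw [abs_le] at *
    constructor <;> linarith
  rw [abs_mul, abs_of_pos hδ] at this
  exact le_of_mul_le_mul_right this hδ

lemma exists_injOn (h : CurveLaw a b c d X X' fL fR w v K B) {t₀ : ℝ} (ht₀ : t₀ ∈ Ioo a b)
    (hX' : X' t₀ ≠ 0) :
    ∃ δ > 0, Icc (t₀ - δ) (t₀ + δ) ⊆ Ioo a b ∧ InjOn X (Icc (t₀ - δ) (t₀ + δ)) := by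
  have e1 : ∀ᶠ t in 𝓝 t₀, X' t ≠ 0 :=
    (h.continuousOn_X'.continuousAt (isOpen_Ioo.mem_nhds ht₀)).eventually_ne hX'
  obtain ⟨δ, hδ, hball⟩ := Metric.eventually_nhds_iff.1 (e1.and (isOpen_Ioo.mem_nhds ht₀))
  have hI : ∀ y ∈ Icc (t₀ - δ / 2) (t₀ + δ / 2), dist y t₀ < δ := fun y hy => by
    rw [Real.dist_eq, abs_lt]
    constructor <;> linarith [hy.1, hy.2]
  have hsub : Icc (t₀ - δ / 2) (t₀ + δ / 2) ⊆ Ioo a b := fun y hy => (hball (hI y hy)).2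
  refine ⟨δ / 2, half_pos hδ, hsub, ?_⟩
  have key : ∀ s ∈ Icc (t₀ - δ / 2) (t₀ + δ / 2), ∀ s' ∈ Icc (t₀ - δ / 2) (t₀ + δ / 2),
      s < s' → X s ≠ X s' := by
    intro s hs s' hs' hlt heq
    have hss : Icc s s' ⊆ Icc (t₀ - δ / 2) (t₀ + δ / 2) := Icc_subset_Icc hs.1 hs'.2
    obtain ⟨ξ, hξ, h0⟩ := exists_hasDerivAt_eq_zero hlt
      (h.continuousOn_X.mono (hss.trans hsub)) heq
      fun x hx => h.hasDerivAt_X x (hsub (hss (Ioo_subset_Icc_self hx)))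
    exact (hball (hI ξ (hss (Ioo_subset_Icc_self hξ)))).1 h0
  intro s hs s' hs' heq
  by_contra hne
  rcases lt_or_gt_of_ne hne with hlt | hlt
  · exact key s hs s' hs' hlt heq
  · exact key s' hs' s hs hlt heq.symm

/-- If the curve is injective on `[t₁, t₃]`, every point off the curve is joined in time, without
crossing the curve, to one of the two end times. -/
lemma abs_sub_le_or_of_injOn (h : CurveLaw a b c d X X' fL fR w v K B) {t₁ t t₃ x : ℝ}
    (hsub : Icc t₁ t₃ ⊆ Ioo a b) (hinj : InjOn X (Icc t₁ t₃)) (ht : t ∈ Icc t₁ t₃)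
    (hx : x ∈ Ioo c d) (hxX : x ≠ X t) :
    |v t x - v t₁ x| ≤ 2 * K * (t - t₁) ∨ |v t₃ x - v t x| ≤ 2 * K * (t₃ - t) := by
  have m1 := left_mem_Icc.2 (ht.1.trans ht.2)
  have m3 := right_mem_Icc.2 (ht.1.trans ht.2)
  by_cases h1 : ∀ s ∈ Icc t₁ t, X s ≠ x
  · exact Or.inl (h.abs_sub_le_of_forall_ne (hsub m1) (hsub ht) ht.1 hx h1)
  · refine Or.inr (h.abs_sub_le_of_forall_ne (hsub ht) (hsub m3) ht.2 hx fun s hs hsx => ?_)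
    push Not at h1
    obtain ⟨s', hs', hs'x⟩ := h1
    have : s' = s := hinj ⟨hs'.1, hs'.2.trans ht.2⟩ ⟨ht.1.trans hs.1, hs.2⟩ (hs'x.trans hsx.symm)
    have e : s' = t := le_antisymm hs'.2 (this ▸ hs.1)
    exact hxX (by rw [← hs'x, e])

lemma w_eq_zero (h : CurveLaw a b c d X X' fL fR w v K B) {t₀ : ℝ} (ht₀ : t₀ ∈ Ioo a b)
    (hX' : X' t₀ ≠ 0) : w t₀ = 0 := by
  obtain ⟨δ₀, hδ₀, hsub₀, hinj₀⟩ := h.exists_injOn ht₀ hX'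
  have hK := h.K_nonneg ht₀
  have hB := h.B_nonneg ht₀
  have hXm := h.X_mem t₀ ht₀
  have key : ∀ δ > 0, δ ≤ δ₀ → |w t₀| ≤ 2 * B * δ := by
    intro δ hδ hδδ
    have hss : Icc (t₀ - δ) (t₀ + δ) ⊆ Icc (t₀ - δ₀) (t₀ + δ₀) :=
      Icc_subset_Icc (by linarith) (by linarith)
    have hsub := hss.trans hsub₀
    have hinj := hinj₀.mono hss
    have m0 : t₀ ∈ Icc (t₀ - δ) (t₀ + δ) := ⟨by linarith, by linarith⟩
    have m1 : t₀ - δ ∈ Icc (t₀ - δ) (t₀ + δ) := ⟨by linarith, by linarith⟩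
    have m3 : t₀ + δ ∈ Icc (t₀ - δ) (t₀ + δ) := ⟨by linarith, by linarith⟩
    have n1 : X t₀ ≠ X (t₀ - δ) := fun e => by linarith [hinj m0 m1 e]
    have n3 : X t₀ ≠ X (t₀ + δ) := fun e => by linarith [hinj m0 m3 e]
    set C := |v (t₀ - δ) (X t₀)| + |v (t₀ + δ) (X t₀)| + 1 + 4 * K * δ with hCdef
    have e1 : ∀ᶠ y in 𝓝 (X t₀), |v (t₀ - δ) y| < |v (t₀ - δ) (X t₀)| + 1 :=
      (h.v_slice (hsub m1) hXm n1).abs.eventually (gt_mem_nhds (lt_add_one _))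
    have e3 : ∀ᶠ y in 𝓝 (X t₀), |v (t₀ + δ) y| < |v (t₀ + δ) (X t₀)| + 1 :=
      (h.v_slice (hsub m3) hXm n3).abs.eventually (gt_mem_nhds (lt_add_one _))
    obtain ⟨ρ, hρ, hball⟩ := Metric.eventually_nhds_iff.1 ((e1.and e3).and
      ((eventually_ne_nhds n1).and (isOpen_Ioo.mem_nhds hXm)))
    have hbound : ∀ t ∈ Icc (t₀ - δ) (t₀ + δ), ∀ x, dist x (X t₀) < ρ → x ≠ X t → |v t x| ≤ C := by
      intro t ht x hx hxX
      obtain ⟨⟨b1, b3⟩, -, hxcd⟩ := hball hx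
      have p1 := abs_nonneg (v (t₀ - δ) (X t₀))
      have p3 := abs_nonneg (v (t₀ + δ) (X t₀))
      rcases h.abs_sub_le_or_of_injOn hsub hinj ht hxcd hxX with h1 | h1
      · have : 2 * K * (t - (t₀ - δ)) ≤ 4 * K * δ := by nlinarith [ht.2]
        have := abs_sub_abs_le_abs_sub (v t x) (v (t₀ - δ) x)
        linarith
      · have : 2 * K * (t₀ + δ - t) ≤ 4 * K * δ := by nlinarith [ht.1]
        have := abs_sub_abs_le_abs_sub (v t x) (v (t₀ + δ) x)
        rw [abs_sub_comm] at h1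
        linarith
    have step : ∀ r > 0, r < ρ → |w t₀| ≤ 2 * B * δ + 4 * C * r := by
      intro r hr hrρ
      have hI : ∀ y ∈ Icc (X t₀ - r) (X t₀ + r), dist y (X t₀) < ρ := fun y hy => by
        rw [Real.dist_eq, abs_lt]
        constructor <;> linarith [hy.1, hy.2]
      have h12 : X t₀ - r ≤ X t₀ + r := by linarith
      have hx₁ := (hball (hI _ (left_mem_Icc.2 h12))).2.2
      have hx₂ := (hball (hI _ (right_mem_Icc.2 h12))).2.2
      have hnot : X (t₀ - δ) ∉ Icc (X t₀ - r) (X t₀ + r) := fun hm =>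
        (hball (hI _ hm)).2.1 rfl
      have hmem : X t₀ ∈ Icc (X t₀ - r) (X t₀ + r) := ⟨by linarith, by linarith⟩
      have hb := h.box_balance hx₁ hx₂ h12 (hsub m1) ht₀ (by linarith)
        (h.continuousAt_integral_of_notMem (hsub m1) hx₁ hx₂ hnot)
        (h.continuousAt_integral ht₀ hx₁ hx₂ (g := fun _ => C) (integrable_const _) (by
          filter_upwards [Icc_mem_nhds (show t₀ - δ < t₀ by linarith)
            (show t₀ < t₀ + δ by linarith)] with s hs x hx hxX
          exact hbound s hs x (hI x hx) hxX))
        ⟨fun e => hnot (by rw [e]; exact left_mem_Icc.2 h12),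
          fun e => hnot (by rw [e]; exact right_mem_Icc.2 h12)⟩
        ⟨by linarith, by linarith⟩
      rw [indicator_of_notMem hnot, indicator_of_mem hmem] at hb
      have h1 := abs_setIntegral_sub_le (A := 0) (ε := C) (z := X (t₀ - δ)) h12
        (h.v_slice_measurable (hsub m1) hx₁ hx₂)
        (fun x hx hxX => by simpa using hbound _ m1 x (hI x hx) hxX)
      have h2 := abs_setIntegral_sub_le (A := 0) (ε := C) (z := X t₀) h12
        (h.v_slice_measurable ht₀ hx₁ hx₂)
        (fun x hx hxX => by simpa using hbound _ m0 x (hI x hx) hxX)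
      have h3 : |∫ t in (t₀ - δ)..t₀, outerIncrement X fL fR (X t₀ - r) (X t₀ + r) t| ≤
          2 * B * |t₀ - (t₀ - δ)| := by
        rw [← Real.norm_eq_abs]
        refine intervalIntegral.norm_integral_le_of_norm_le_const fun t ht => ?_
        rw [uIoc_of_le (by linarith)] at ht
        exact h.abs_outerIncrement_le (hsub ⟨ht.1.le, by linarith [ht.2]⟩) hx₁ hx₂
      rw [sub_sub_cancel, abs_of_pos hδ] at h3
      simp only [Pi.one_apply, mul_one, mul_zero, sub_zero, zero_mul] at hb h1 h2
      have hw : w t₀ = (∫ t in (t₀ - δ)..t₀, outerIncrement X fL fR (X t₀ - r) (X t₀ + r) t) -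
          ((∫ x in Icc (X t₀ - r) (X t₀ + r), v t₀ x) -
            ∫ x in Icc (X t₀ - r) (X t₀ + r), v (t₀ - δ) x) := by linarith
      rw [hw]
      rw [abs_le] at *
      constructor <;> linarith
    have hlim : Tendsto (fun r => 2 * B * δ + 4 * C * r) (𝓝[>] 0) (𝓝 (2 * B * δ + 4 * C * 0)) :=
      ((continuous_const.add (continuous_const.mul continuous_id)).tendsto 0).mono_left
        nhdsWithin_le_nhds
    have := ge_of_tendsto hlim (by
      filter_upwards [Ioo_mem_nhdsGT hρ] with r hr
      exact step r hr.1 hr.2)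
    simpa using this
  have hlim : Tendsto (fun r => 2 * B * r) (𝓝[>] 0) (𝓝 (2 * B * 0)) :=
    ((continuous_const.mul continuous_id).tendsto 0).mono_left nhdsWithin_le_nhds
  have := ge_of_tendsto hlim (by
    filter_upwards [Ioo_mem_nhdsGT hδ₀] with r hr
    exact key r hr.1 hr.2.le)
  rw [mul_zero] at this
  exact abs_nonpos_iff.1 this

end CurveLaw

namespace CurveLaw

variable {a b c d : ℝ} {X X' : ℝ → ℝ} {fL fR : ℝ → ℝ → ℝ} {w : ℝ → ℝ} {v : ℝ → ℝ → ℝ} {K B : ℝ}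

lemma jump_continuousOn (h : CurveLaw a b c d X X' fL fR w v K B) :
    ContinuousOn (jump X fL fR) (Ioo a b) := by
  have hc : ContinuousOn (fun t => (t, X t)) (Ioo a b) := continuousOn_id.prodMk h.continuousOn_X
  exact (h.fR_cont.comp hc fun t ht => ⟨ht, h.X_mem t ht⟩).sub
    (h.fL_cont.comp hc fun t ht => ⟨ht, h.X_mem t ht⟩)

lemma jump_continuousAt (h : CurveLaw a b c d X X' fL fR w v K B) {t : ℝ} (ht : t ∈ Ioo a b) :
    ContinuousAt (jump X fL fR) t :=
  h.jump_continuousOn.continuousAt (isOpen_Ioo.mem_nhds ht)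

lemma jump_intervalIntegrable (h : CurveLaw a b c d X X' fL fR w v K B) {t₁ t₂ : ℝ}
    (ht₁ : t₁ ∈ Ioo a b) (ht₂ : t₂ ∈ Ioo a b) :
    IntervalIntegrable (jump X fL fR) volume t₁ t₂ :=
  (h.jump_continuousOn.mono (ordConnected_Ioo.uIcc_subset ht₁ ht₂)).intervalIntegrable

/-- While the curve stands still, the atom grows by the time integral of the jump. -/
lemma w_sub_eq_integral_jump (h : CurveLaw a b c d X X' fL fR w v K B) {s₁ s₂ x₀ t₁ t₂ : ℝ}
    (hs : Ioo s₁ s₂ ⊆ Ioo a b) (hX : ∀ t ∈ Ioo s₁ s₂, X t = x₀)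
    (ht₁ : t₁ ∈ Ioo s₁ s₂) (ht₂ : t₂ ∈ Ioo s₁ s₂) (ht12 : t₁ ≤ t₂) :
    w t₂ - w t₁ = ∫ t in t₁..t₂, jump X fL fR t := by
  have hK := h.K_nonneg (hs ht₁)
  have hx₀ : x₀ ∈ Ioo c d := hX t₁ ht₁ ▸ h.X_mem t₁ (hs ht₁)
  obtain ⟨ρ, hρ, hball⟩ := Metric.eventually_nhds_iff.1 (isOpen_Ioo.mem_nhds hx₀)
  obtain ⟨s, hsm, hsi⟩ : ∃ s ∈ Ioo s₁ s₂, IntegrableOn (v s) (Ioo c d) := by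
    have h1 := ae_restrict_of_ae_restrict_of_subset hs (integrable_slice_ae h.v_int)
    have h2 : (ae (volume.restrict (Ioo s₁ s₂))).NeBot := by
      rw [ae_neBot, Ne, Measure.restrict_eq_zero, Real.volume_Ioo, ENNReal.ofReal_eq_zero]
      linarith [ht₁.1, ht₁.2]
    exact ((ae_restrict_mem measurableSet_Ioo).and h1).exists
  have hlip : ∀ t ∈ Ioo s₁ s₂, ∀ t' ∈ Ioo s₁ s₂, t ≤ t' → ∀ x ∈ Ioo c d, x ≠ x₀ →
      |v t' x - v t x| ≤ 2 * K * (t' - t) := fun t ht t' ht' htt x hx hxx =>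
    h.abs_sub_le_of_forall_ne (hs ht) (hs ht') htt hx fun y hy => by
      rw [hX y ⟨ht.1.trans_le hy.1, hy.2.trans_lt ht'.2⟩]; exact hxx.symm
  have hbound : ∀ t ∈ Ioo s₁ s₂, ∀ x ∈ Ioo c d, x ≠ x₀ →
      |v t x| ≤ |v s x| + 2 * K * (s₂ - s₁) := by
    intro t ht x hx hxx
    have h0 := abs_sub_abs_le_abs_sub (v t x) (v s x)
    rcases le_total s t with hst | hst
    · have h1 := hlip s hsm t ht hst x hx hxx
      have : K * (t - s) ≤ K * (s₂ - s₁) :=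
        mul_le_mul_of_nonneg_left (by linarith [ht.2, hsm.1]) hK
      linarith
    · have h1 := hlip t ht s hsm hst x hx hxx
      rw [abs_sub_comm] at h1
      have : K * (s - t) ≤ K * (s₂ - s₁) :=
        mul_le_mul_of_nonneg_left (by linarith [ht.1, hsm.2]) hK
      linarith
  set J := ∫ t in t₁..t₂, jump X fL fR t with hJ
  have step : ∀ r > 0, r < ρ → |w t₂ - w t₁ - J| ≤ 8 * K * (t₂ - t₁) * r := by
    intro r hr hrρ
    have hI : ∀ y ∈ Icc (x₀ - r) (x₀ + r), dist y x₀ < ρ := fun y hy => by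
      rw [Real.dist_eq, abs_lt]
      constructor <;> linarith [hy.1, hy.2]
    have h12 : x₀ - r ≤ x₀ + r := by linarith
    have hx₁ := hball (hI _ (left_mem_Icc.2 h12))
    have hx₂ := hball (hI _ (right_mem_Icc.2 h12))
    have hmem : x₀ ∈ Icc (x₀ - r) (x₀ + r) := ⟨by linarith, by linarith⟩
    have hIs : Icc (x₀ - r) (x₀ + r) ⊆ Ioo c d := fun y hy => hball (hI y hy)
    have hg : IntegrableOn (fun x => |v s x| + 2 * K * (s₂ - s₁)) (Icc (x₀ - r) (x₀ + r)) :=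
      (hsi.mono_set hIs).abs.add (integrable_const _)
    have hcont : ∀ t ∈ Ioo s₁ s₂,
        ContinuousAt (fun t => ∫ x in Icc (x₀ - r) (x₀ + r), v t x) t := fun t ht =>
      h.continuousAt_integral (hs ht) hx₁ hx₂ hg (by
        filter_upwards [isOpen_Ioo.mem_nhds ht] with t' ht' x hx hxX
        rw [hX t' ht'] at hxX
        exact hbound t' ht' x (hIs hx) hxX)
    have hvi : ∀ t ∈ Ioo s₁ s₂, IntegrableOn (v t) (Icc (x₀ - r) (x₀ + r)) := fun t ht =>
      hg.mono' (h.v_slice_measurable (hs ht) hx₁ hx₂) (by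
        filter_upwards [ae_restrict_mem measurableSet_Icc,
          ae_restrict_of_ae (Measure.ae_ne volume x₀)] with x hx hz
        exact hbound t ht x (hIs hx) hz)
    have hne : ∀ t ∈ Ioo s₁ s₂, X t ≠ x₀ - r ∧ X t ≠ x₀ + r := fun t ht => by
      rw [hX t ht]
      constructor <;> intro e <;> linarith
    have hb := h.box_balance hx₁ hx₂ h12 (hs ht₁) (hs ht₂) ht12 (hcont _ ht₁) (hcont _ ht₂)
      (hne _ ht₁) (hne _ ht₂)
    rw [hX t₁ ht₁, hX t₂ ht₂, indicator_of_mem hmem, Pi.one_apply, mul_one, mul_one,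
      ← integral_sub (hvi _ ht₂) (hvi _ ht₁)] at hb
    have h1 := abs_setIntegral_sub_le (A := 0) (z := x₀) (f := fun x => v t₂ x - v t₁ x) h12
      ((hvi _ ht₂).sub (hvi _ ht₁)).aestronglyMeasurable (fun x hx hxx => by
        simpa using hlip t₁ ht₁ t₂ ht₂ ht12 x (hIs hx) hxx)
    have h2 : |(∫ t in t₁..t₂, outerIncrement X fL fR (x₀ - r) (x₀ + r) t) - J| ≤
        2 * K * (x₀ + r - (x₀ - r)) * |t₂ - t₁| := by
      rw [hJ, ← intervalIntegral.integral_sub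
        (h.outerIncrement_intervalIntegrable hx₁ hx₂ (hs ht₁) (hs ht₂))
        (h.jump_intervalIntegrable (hs ht₁) (hs ht₂)), ← Real.norm_eq_abs]
      refine intervalIntegral.norm_integral_le_of_norm_le_const fun t ht => ?_
      rw [uIoc_of_le ht12] at ht
      have ht' : t ∈ Ioo s₁ s₂ := ⟨ht₁.1.trans ht.1, ht.2.trans_lt ht₂.2⟩
      exact h.abs_outerIncrement_sub_jump_le (hs ht') hx₁ hx₂ ((hX t ht').symm ▸ hmem)
    rw [abs_of_nonneg (sub_nonneg.2 ht12)] at h2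
    rw [← hb] at h2
    have e : x₀ + r - (x₀ - r) = 2 * r := by ring
    rw [e] at h1 h2
    simp only [zero_mul, sub_zero] at h1
    rw [abs_le] at *
    constructor <;> linarith
  have hlim : Tendsto (fun r => 8 * K * (t₂ - t₁) * r) (𝓝[>] 0) (𝓝 (8 * K * (t₂ - t₁) * 0)) :=
    ((continuous_const.mul continuous_id).tendsto 0).mono_left nhdsWithin_le_nhds
  have := ge_of_tendsto hlim (by
    filter_upwards [Ioo_mem_nhdsGT hρ] with r hr
    exact step r hr.1 hr.2)
  rw [mul_zero] at this
  exact sub_eq_zero.1 (abs_nonpos_iff.1 this)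

/-- If the curve stands still just before `t₀`, the atom grows at the rate given by the jump. -/
lemma deriv_eq_jump_of_const (h : CurveLaw a b c d X X' fL fR w v K B) {w' : ℝ → ℝ} {s t₀ x₀ : ℝ}
    (ht₀ : t₀ ∈ Ioo a b) (hs : s ∈ Ioo a b) (hst : s < t₀) (hX : ∀ t ∈ Ioo s t₀, X t = x₀)
    (hw : ∀ t ∈ Ioo a b, HasDerivAt w (w' t) t) (hw' : ContinuousOn w' (Ioo a b)) :
    w' t₀ = jump X fL fR t₀ := by
  have hsub : Ioo s t₀ ⊆ Ioo a b := Ioo_subset_Ioo hs.1.le ht₀.2.le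
  have key : ∀ t ∈ Ioo s t₀, w' t = jump X fL fR t := by
    intro t ht
    have h1 : HasDerivAt (fun τ => w t + ∫ x in t..τ, jump X fL fR x) (jump X fL fR t) t :=
      (intervalIntegral.integral_hasDerivAt_right (by simp)
        (h.jump_continuousOn.stronglyMeasurableAtFilter isOpen_Ioo t (hsub ht))
        (h.jump_continuousAt (hsub ht))).const_add _
    have h2 : HasDerivWithinAt w (jump X fL fR t) (Ici t) t := by
      refine h1.hasDerivWithinAt.congr_of_eventuallyEq ?_ (by simp)
      filter_upwards [self_mem_nhdsWithin, nhdsWithin_le_nhds (isOpen_Ioo.mem_nhds ht)] with τ h3 h4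
      rw [← h.w_sub_eq_integral_jump hsub hX ht h4 h3]
      ring
    exact (uniqueDiffWithinAt_Ici t).eq_deriv _ (hw t (hsub ht)).hasDerivWithinAt h2
  have l1 : Tendsto w' (𝓝[<] t₀) (𝓝 (w' t₀)) :=
    (hw'.continuousAt (isOpen_Ioo.mem_nhds ht₀)).tendsto.mono_left nhdsWithin_le_nhds
  have l2 : Tendsto (jump X fL fR) (𝓝[<] t₀) (𝓝 (jump X fL fR t₀)) :=
    (h.jump_continuousAt ht₀).tendsto.mono_left nhdsWithin_le_nhds
  refine tendsto_nhds_unique_of_eventuallyEq l1 l2 ?_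
  filter_upwards [Ioo_mem_nhdsLT hst] with t ht using key t ht

end CurveLaw

lemma mem_uIcc_iff_of_injOn {f : ℝ → ℝ} {p q s₁ s₂ t : ℝ} (hc : ContinuousOn f (Icc p q))
    (hi : InjOn f (Icc p q)) (h₁ : s₁ ∈ Icc p q) (h₂ : s₂ ∈ Icc p q) (h12 : s₁ ≤ s₂)
    (ht : t ∈ Icc p q) : f t ∈ uIcc (f s₁) (f s₂) ↔ t ∈ Icc s₁ s₂ := by
  rcases hc.strictMonoOn_of_injOn_Icc' (h₁.1.trans h₁.2) hi with hm | hm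
  · rw [uIcc_of_le ((hm.le_iff_le h₁ h₂).2 h12), mem_Icc, mem_Icc, hm.le_iff_le h₁ ht,
      hm.le_iff_le ht h₂]
  · rw [uIcc_of_ge ((hm.le_iff_ge h₂ h₁).2 h12), mem_Icc, mem_Icc, hm.le_iff_ge h₂ ht,
      hm.le_iff_ge ht h₁, and_comm]

lemma tendsto_abs_increment_div {f : ℝ → ℝ} {f' t₀ : ℝ} (hf : HasDerivAt f f' t₀) :
    Tendsto (fun η => |f (t₀ - η) - f (t₀ - 2 * η)| / η) (𝓝[>] 0) (𝓝 |f'|) := by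
  have h1 : HasDerivAt (fun η => f (t₀ - η)) (f' * -1) 0 :=
    HasDerivAt.comp (h₂ := f) 0 (by simpa using hf)
      (by simpa using (hasDerivAt_id (0 : ℝ)).const_sub t₀)
  have h2 : HasDerivAt (fun η => f (t₀ - 2 * η)) (f' * -2) 0 :=
    HasDerivAt.comp (h₂ := f) 0 (by simpa using hf)
      (by simpa using ((hasDerivAt_id (0 : ℝ)).const_mul 2).const_sub t₀)
  have h3 := ((hasDerivAt_iff_tendsto_slope_zero.1 (h1.sub h2)).mono_left
    (nhdsWithin_mono 0 fun x hx => ne_of_gt hx : 𝓝[>] (0 : ℝ) ≤ 𝓝[≠] 0)).abs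
  have e : f' * -1 - f' * -2 = f' := by ring
  rw [e] at h3
  refine h3.congr' ?_
  filter_upwards [self_mem_nhdsWithin] with η hη
  have hη' : (0 : ℝ) < η := hη
  simp [abs_mul, abs_of_pos hη', div_eq_inv_mul]

namespace CurveLaw

variable {a b c d : ℝ} {X X' : ℝ → ℝ} {fL fR : ℝ → ℝ → ℝ} {w : ℝ → ℝ} {v : ℝ → ℝ → ℝ} {K B : ℝ}

/-- If the curve has zero speed at `t₀` but keeps moving just before `t₀`, then there is no jump. -/
lemma jump_eq_zero_of_frequently (h : CurveLaw a b c d X X' fL fR w v K B) {t₀ C₀ : ℝ}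
    (ht₀ : t₀ ∈ Ioo a b) (hX' : X' t₀ = 0) (hfreq : ∃ᶠ t in 𝓝[<] t₀, X t ≠ X t₀)
    (hv : ∀ᶠ x in 𝓝 (X t₀), x ≠ X t₀ → |v t₀ x| ≤ C₀) : jump X fL fR t₀ = 0 := by
  by_contra hj
  have hK := h.K_nonneg ht₀
  have hXm := h.X_mem t₀ ht₀
  set j := jump X fL fR t₀
  have hj' : 0 < |j| := abs_pos.2 hj
  have ej : ∀ᶠ t in 𝓝 t₀, |jump X fL fR t - j| < |j| / 2 :=
    Metric.continuousAt_iff'.1 (h.jump_continuousAt ht₀) _ (half_pos hj')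
  obtain ⟨δ, hδ, hδball⟩ := Metric.eventually_nhds_iff.1 (ej.and (isOpen_Ioo.mem_nhds ht₀))
  obtain ⟨t₁, hX₁, ht₁⟩ := (hfreq.and_eventually
    (Ioo_mem_nhdsLT (show t₀ - δ < t₀ by linarith))).exists
  have hδI : ∀ t ∈ Icc t₁ t₀, |jump X fL fR t - j| < |j| / 2 ∧ t ∈ Ioo a b := fun t ht =>
    hδball (by rw [Real.dist_eq, abs_lt]; constructor <;> linarith [ht.1, ht.2, ht₁.1])
  have hsub : Icc t₁ t₀ ⊆ Ioo a b := fun t ht => (hδI t ht).2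
  have m1 := hsub (left_mem_Icc.2 ht₁.2.le)
  set C := |v t₁ (X t₀)| + 1 + |C₀| with hC
  have hCpos : 0 < C := by positivity
  have e1 : ∀ᶠ x in 𝓝 (X t₀), |v t₁ x| < |v t₁ (X t₀)| + 1 :=
    (h.v_slice m1 hXm hX₁.symm).abs.eventually (gt_mem_nhds (lt_add_one _))
  obtain ⟨ρ₀, hρ₀, hball⟩ := Metric.eventually_nhds_iff.1 ((hv.and e1).and
    ((eventually_ne_nhds hX₁.symm).and (isOpen_Ioo.mem_nhds hXm)))
  set M := 4 * C + 4 * K * (t₀ - t₁) with hM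
  have hMpos : 0 ≤ M := by
    have := mul_nonneg hK (sub_nonneg.2 ht₁.2.le)
    linarith
  set ε := |j| / (2 * (M + 1)) with hε
  have hεpos : 0 < ε := by positivity
  have eε : |j| = 2 * ε * (M + 1) := by rw [hε]; field_simp
  have eX' : ∀ᶠ t in 𝓝 t₀, |X' t| < ε := by
    have := Metric.continuousAt_iff'.1
      (h.continuousOn_X'.continuousAt (isOpen_Ioo.mem_nhds ht₀)) _ hεpos
    simpa [hX', Real.dist_eq] using this
  obtain ⟨δ₂, hδ₂, hδ₂ball⟩ := Metric.eventually_nhds_iff.1 eX'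
  have eX : ∀ᶠ t in 𝓝 t₀, dist (X t) (X t₀) < ρ₀ / 2 :=
    Metric.continuousAt_iff'.1 (h.continuousAt_X ht₀) _ (half_pos hρ₀)
  obtain ⟨s₂, hX₂, ⟨hs₂, hs₂'⟩, hs₂X⟩ := (hfreq.and_eventually
    ((show ∀ᶠ t in 𝓝[<] t₀, t ∈ Ioo (max t₁ (t₀ - δ₂)) t₀ from
      Ioo_mem_nhdsLT (max_lt ht₁.2 (by linarith))).and (nhdsWithin_le_nhds eX))).exists
  obtain ⟨hs₂1, hs₂2⟩ := max_lt_iff.1 hs₂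
  set ρ := |X t₀ - X s₂| / 2 with hρ
  have hρpos : 0 < ρ := half_pos (abs_pos.2 (sub_ne_zero.2 hX₂.symm))
  have hspeed : ∀ t ∈ Icc s₂ t₀, |X t - X s₂| ≤ ε * (t - s₂) := by
    intro t ht
    have := (convex_Icc s₂ t₀).norm_image_sub_le_of_norm_hasDerivWithin_le (f := X) (C := ε)
      (fun x hx => (h.hasDerivAt_X x (hsub ⟨hs₂1.le.trans hx.1, hx.2⟩)).hasDerivWithinAt)
      (fun x hx => (hδ₂ball (by
        rw [Real.dist_eq, abs_lt]; constructor <;> linarith [hx.1, hx.2])).le)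
      (left_mem_Icc.2 hs₂'.le) ht
    rwa [Real.norm_eq_abs, Real.norm_eq_abs, abs_of_nonneg (sub_nonneg.2 ht.1)] at this
  have hlen : ρ / ε ≤ t₀ - s₂ := by
    rw [div_le_iff₀ hεpos]
    have := hspeed t₀ (right_mem_Icc.2 hs₂'.le)
    linarith
  have hρε : 0 < ρ / ε := div_pos hρpos hεpos
  have hJ : ∀ t ∈ Icc s₂ (s₂ + ρ / ε), X t ∈ Icc (X s₂ - ρ) (X s₂ + ρ) := by
    intro t ht
    have h1 := hspeed t ⟨ht.1, by linarith [ht.2]⟩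
    have h2 : ε * (t - s₂) ≤ ε * (ρ / ε) :=
      mul_le_mul_of_nonneg_left (by linarith [ht.2]) hεpos.le
    rw [mul_div_cancel₀ _ hεpos.ne'] at h2
    have := abs_le.1 (h1.trans h2)
    exact ⟨by linarith, by linarith⟩
  have hI : ∀ y ∈ Icc (X s₂ - ρ) (X s₂ + ρ), dist y (X t₀) < ρ₀ := by
    intro y hy
    have h1 : dist y (X s₂) ≤ ρ := by
      rw [Real.dist_eq, abs_le]
      constructor <;> linarith [hy.1, hy.2]
    have h2 : dist (X s₂) (X t₀) = 2 * ρ := by rw [dist_comm, Real.dist_eq, hρ]; ring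
    have := dist_triangle y (X s₂) (X t₀)
    linarith
  have h12 : X s₂ - ρ ≤ X s₂ + ρ := by linarith
  have hx₁ := (hball (hI _ (left_mem_Icc.2 h12))).2.2
  have hx₂ := (hball (hI _ (right_mem_Icc.2 h12))).2.2
  have hn₁ : X t₁ ∉ Icc (X s₂ - ρ) (X s₂ + ρ) := fun hm => (hball (hI _ hm)).2.1 rfl
  have hn₀ : X t₀ ∉ Icc (X s₂ - ρ) (X s₂ + ρ) := fun hm => by
    have : |X t₀ - X s₂| ≤ ρ := abs_le.2 ⟨by linarith [hm.1], by linarith [hm.2]⟩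
    linarith
  have hp1 := abs_nonneg (v t₁ (X t₀))
  have hb := h.box_balance_of_notMem (A₁ := 0) (A₂ := 0) (ε := C) (z := X t₀) hx₁ hx₂ h12 m1 ht₀
    ht₁.2.le hn₁ hn₀
    (fun x hx _ => by
      rw [sub_zero]
      linarith [(hball (hI x hx)).1.2, abs_nonneg C₀])
    (fun x hx hxX => by
      rw [sub_zero]
      linarith [(hball (hI x hx)).1.1 hxX, le_abs_self C₀])
  have e2ρ : X s₂ + ρ - (X s₂ - ρ) = 2 * ρ := by ring
  rw [e2ρ, sub_zero, zero_mul, zero_sub, abs_neg] at hb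
  set oi := outerIncrement X fL fR (X s₂ - ρ) (X s₂ + ρ)
  have hoi_ne : ∀ t ∈ Icc t₁ t₀, 0 ≤ j * oi t + 4 * K * ρ * |j| ∧
      (t ∈ Icc s₂ (s₂ + ρ / ε) → j ^ 2 / 2 ≤ j * oi t + 4 * K * ρ * |j|) := by
    intro t ht
    have hin : X t ∈ Icc (X s₂ - ρ) (X s₂ + ρ) → j ^ 2 / 2 ≤ j * oi t + 4 * K * ρ * |j| := by
      intro hXt
      have h1 := h.abs_outerIncrement_sub_jump_le (hsub ht) hx₁ hx₂ hXt
      rw [e2ρ] at h1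
      have h2 := (hδI t ht).1
      have h3 : |oi t - j| ≤ 4 * K * ρ + |j| / 2 := by
        have := abs_sub_le (oi t) (jump X fL fR t) j
        linarith
      have h4 : |j * (oi t - j)| ≤ |j| * (4 * K * ρ + |j| / 2) := by
        rw [abs_mul]
        exact mul_le_mul_of_nonneg_left h3 hj'.le
      have := neg_le_of_abs_le h4
      have := sq_abs j
      nlinarith
    refine ⟨?_, fun hts => hin (hJ t hts)⟩
    by_cases hXt : X t ∈ Icc (X s₂ - ρ) (X s₂ + ρ)
    · exact le_trans (by positivity) (hin hXt)
    · have h1 := h.abs_outerIncrement_le_of_notMem (hsub ht) hx₁ hx₂ h12 hXt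
      rw [e2ρ] at h1
      have h4 : |j * oi t| ≤ |j| * (2 * K * (2 * ρ)) := by
        rw [abs_mul]
        exact mul_le_mul_of_nonneg_left h1 hj'.le
      have := neg_le_of_abs_le h4
      linarith
  have hoi : ∀ p ∈ Ioo a b, ∀ q ∈ Ioo a b,
      IntervalIntegrable (fun t => j * oi t + 4 * K * ρ * |j|) volume p q := fun p hp q hq =>
    ((h.outerIncrement_intervalIntegrable hx₁ hx₂ hp hq).const_mul j).add (by simp)
  have ms₂ : s₂ ∈ Ioo a b := hsub ⟨hs₂1.le, hs₂'.le⟩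
  have ms₃ : s₂ + ρ / ε ∈ Ioo a b := hsub ⟨by linarith, by linarith⟩
  have i1 : (s₂ + ρ / ε - s₂) * (j ^ 2 / 2) ≤
      ∫ t in s₂..s₂ + ρ / ε, (j * oi t + 4 * K * ρ * |j|) := by
    rw [← smul_eq_mul, ← intervalIntegral.integral_const]
    exact intervalIntegral.integral_mono_on (by linarith) (by simp) (hoi _ ms₂ _ ms₃)
      fun t ht => (hoi_ne t ⟨hs₂1.le.trans ht.1, by linarith [ht.2]⟩).2 ht
  have i2 : ∫ t in s₂..s₂ + ρ / ε, (j * oi t + 4 * K * ρ * |j|) ≤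
      ∫ t in t₁..t₀, (j * oi t + 4 * K * ρ * |j|) := by
    refine intervalIntegral.integral_mono_interval hs₂1.le (by linarith) (by linarith) ?_
      (hoi _ m1 _ ht₀)
    filter_upwards [ae_restrict_mem measurableSet_Ioc] with t ht
    exact (hoi_ne t (Ioc_subset_Icc_self ht)).1
  have i3 : ∫ t in t₁..t₀, (j * oi t + 4 * K * ρ * |j|) =
      j * (∫ t in t₁..t₀, oi t) + (t₀ - t₁) * (4 * K * ρ * |j|) := by
    rw [intervalIntegral.integral_add
      ((h.outerIncrement_intervalIntegrable hx₁ hx₂ m1 ht₀).const_mul j) (by simp),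
      intervalIntegral.integral_const_mul, intervalIntegral.integral_const, smul_eq_mul]
  have i4 : j * (∫ t in t₁..t₀, oi t) ≤ |j| * (2 * C * (2 * ρ)) :=
    (le_abs_self _).trans (by rw [abs_mul]; exact mul_le_mul_of_nonneg_left hb hj'.le)
  have hfin : ρ / ε * (|j| * |j| / 2) ≤ |j| * ρ * M := by
    have e0 : |j| * |j| = j ^ 2 := by rw [← sq, sq_abs]
    rw [e0, hM]
    have : s₂ + ρ / ε - s₂ = ρ / ε := by ring
    rw [this] at i1
    linarith
  have e3 : ρ / ε * (|j| * |j| / 2) = |j| * ρ * (M + 1) := by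
    nth_rewrite 2 [eε]
    field_simp
  rw [e3] at hfin
  nlinarith [mul_pos hj' hρpos]

/-- The jump relation at a time when the curve moves, where `N` is the limit of `v t₀` on the side
`S` that the curve comes from and `F` the limit on the other side `S'`. -/
lemma abs_speed_mul_sub_eq_jump (h : CurveLaw a b c d X X' fL fR w v K B) {t₀ N F : ℝ}
    {S S' : Set ℝ} (ht₀ : t₀ ∈ Ioo a b) (hX' : X' t₀ ≠ 0) (hS : S.OrdConnected)
    (hSS : Disjoint S S') (hX₀ : X t₀ ∉ S') [(𝓝[S'] (X t₀)).NeBot]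
    (hXS : ∀ᶠ t in 𝓝[<] t₀, X t ∈ S)
    (hN : Tendsto (v t₀) (𝓝[S] (X t₀)) (𝓝 N)) (hF : Tendsto (v t₀) (𝓝[S'] (X t₀)) (𝓝 F)) :
    |X' t₀| * (N - F) = jump X fL fR t₀ := by
  have hK := h.K_nonneg ht₀
  have hXm := h.X_mem t₀ ht₀
  obtain ⟨δ, hδ, hδsub, hinj₀⟩ := h.exists_injOn ht₀ hX'
  obtain ⟨τ, hτ, hτS⟩ := (mem_nhdsLT_iff_exists_Ioo_subset' (sub_one_lt t₀)).1 hXS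
  set j := jump X fL fR t₀
  have key : ∀ t₁ < t₀, t₀ - δ ≤ t₁ → τ < t₁ →
      |(|X' t₀| * (N - F) - j)| ≤ 4 * K * |X' t₀| * (t₀ - t₁) := by
    intro t₁ ht₁ hδ₁ hτ₁
    have hI₀ : Icc t₁ t₀ ⊆ Icc (t₀ - δ) (t₀ + δ) := Icc_subset_Icc hδ₁ (by linarith)
    have hsub := hI₀.trans hδsub
    have hinj := hinj₀.mono hI₀
    have m0 := right_mem_Icc.2 ht₁.le
    have m1 := left_mem_Icc.2 ht₁.le
    have hXS' : ∀ t ∈ Ico t₁ t₀, X t ∈ S := fun t ht => hτS ⟨hτ₁.trans_le ht.1, ht.2⟩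
    have hX₁ : X t₀ ≠ X t₁ := fun e => ht₁.ne' (hinj m0 m1 e)
    have hA := h.v_slice (hsub m1) hXm hX₁
    set A := v t₁ (X t₀)
    have hQ : |F - A| ≤ 2 * K * (t₀ - t₁) := by
      refine le_of_tendsto (hF.sub (hA.tendsto.mono_left nhdsWithin_le_nhds)).abs ?_
      filter_upwards [self_mem_nhdsWithin, nhdsWithin_le_nhds (isOpen_Ioo.mem_nhds hXm)]
        with x hxS hxm
      refine h.abs_sub_le_of_forall_ne (hsub m1) ht₀ ht₁.le hxm fun s hs hsx => ?_
      rcases hs.2.eq_or_lt with rfl | hlt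
      · exact hX₀ (hsx ▸ hxS)
      · exact disjoint_left.1 hSS (hXS' s ⟨hs.1, hlt⟩) (hsx ▸ hxS)
    have hP : ∀ ε > 0, |(N - A) * |X' t₀| - j| ≤
        2 * ε * |X' t₀| + 2 * K * |X' t₀| * (t₀ - t₁) + ε := by
      intro ε hε
      have e0 : ∀ᶠ x in 𝓝 (X t₀), x ∈ S → |v t₀ x - N| < ε :=
        eventually_nhdsWithin_iff.1 (Metric.tendsto_nhds.1 hN ε hε)
      have e1 : ∀ᶠ x in 𝓝 (X t₀), |v t₁ x - A| < ε := Metric.tendsto_nhds.1 hA.tendsto ε hε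
      obtain ⟨ρ, hρ, hball⟩ := Metric.eventually_nhds_iff.1 ((e0.and e1).and
        (isOpen_Ioo.mem_nhds hXm))
      have e2 : ∀ᶠ t in 𝓝 t₀, X t ∈ Metric.ball (X t₀) ρ :=
        Metric.tendsto_nhds.1 (h.continuousAt_X ht₀).tendsto ρ hρ
      have e3 : ∀ᶠ t in 𝓝 t₀, |jump X fL fR t - j| < ε :=
        Metric.tendsto_nhds.1 (h.jump_continuousAt ht₀).tendsto ε hε
      obtain ⟨δ₂, hδ₂, hball₂⟩ := Metric.eventually_nhds_iff.1 (e2.and e3)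
      have step : ∀ η ∈ Ioo 0 (min (δ₂ / 2) ((t₀ - t₁) / 2)),
          |(N - A) * |X (t₀ - η) - X (t₀ - 2 * η)| - η * j| ≤
            2 * ε * |X (t₀ - η) - X (t₀ - 2 * η)| +
              2 * K * |X (t₀ - η) - X (t₀ - 2 * η)| * (t₀ - t₁) + ε * η := by
        rintro η ⟨hη, hη'⟩
        obtain ⟨hη1, hη2⟩ := lt_min_iff.1 hη'
        set s₁ := t₀ - 2 * η with hs₁
        set s₂ := t₀ - η with hs₂
        have ms₁ : s₁ ∈ Icc t₁ t₀ := ⟨by linarith, by linarith⟩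
        have ms₂ : s₂ ∈ Icc t₁ t₀ := ⟨by linarith, by linarith⟩
        have hiff : ∀ t ∈ Icc t₁ t₀, X t ∈ Icc (X s₁ ⊓ X s₂) (X s₁ ⊔ X s₂) ↔ t ∈ Icc s₁ s₂ :=
          fun t ht => mem_uIcc_iff_of_injOn (h.continuousOn_X.mono hsub) hinj ms₁ ms₂
            (by linarith) ht
        have hlen : X s₁ ⊔ X s₂ - X s₁ ⊓ X s₂ = |X s₂ - X s₁| := max_sub_min_eq_abs' _ _ |>.trans
          (abs_sub_comm _ _)
        have h12 : X s₁ ⊓ X s₂ ≤ X s₁ ⊔ X s₂ := inf_le_sup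
        have hs : ∀ s ∈ Icc s₁ s₂, dist s t₀ < δ₂ := fun s hs => by
          rw [Real.dist_eq, abs_lt]
          constructor <;> linarith [hs.1, hs.2]
        have hI : Icc (X s₁ ⊓ X s₂) (X s₁ ⊔ X s₂) ⊆ Metric.ball (X t₀) ρ :=
          (convex_ball (X t₀) ρ).ordConnected.uIcc_subset
            (hball₂ (hs s₁ ⟨le_rfl, by linarith⟩)).1 (hball₂ (hs s₂ ⟨by linarith, le_rfl⟩)).1
        have hIS : Icc (X s₁ ⊓ X s₂) (X s₁ ⊔ X s₂) ⊆ S :=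
          hS.uIcc_subset (hXS' s₁ ⟨ms₁.1, by linarith⟩) (hXS' s₂ ⟨ms₂.1, by linarith⟩)
        have hx₁ := (hball (hI (left_mem_Icc.2 h12))).2
        have hx₂ := (hball (hI (right_mem_Icc.2 h12))).2
        have hb := h.box_balance_of_notMem (A₁ := A) (A₂ := N) (ε := ε) (z := X t₀) hx₁ hx₂ h12
          (hsub m1) ht₀ ht₁.le (fun hm => by linarith [((hiff t₁ m1).1 hm).1])
          (fun hm => by linarith [((hiff t₀ m0).1 hm).2])
          (fun x hx _ => (hball (hI hx)).1.2.le)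
          (fun x hx _ => ((hball (hI hx)).1.1 (hIS hx)).le)
        set oi := outerIncrement X fL fR (X s₁ ⊓ X s₂) (X s₁ ⊔ X s₂)
        set L := |X s₂ - X s₁| with hL
        rw [hlen] at hb
        have hii : ∀ p ∈ Icc t₁ t₀, ∀ q ∈ Icc t₁ t₀, IntervalIntegrable oi volume p q :=
          fun p hp q hq => h.outerIncrement_intervalIntegrable hx₁ hx₂ (hsub hp) (hsub hq)
        have i1 : |∫ t in t₁..s₁, oi t| ≤ 2 * K * L * |s₁ - t₁| := by
          rw [← Real.norm_eq_abs]
          refine intervalIntegral.norm_integral_le_of_norm_le_const_ae ?_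
          filter_upwards [Measure.ae_ne volume s₁] with t hne ht
          rw [uIoc_of_le ms₁.1] at ht
          have ht' : t ∈ Icc t₁ t₀ := ⟨ht.1.le, ht.2.trans ms₁.2⟩
          rw [← hlen]
          exact h.abs_outerIncrement_le_of_notMem (hsub ht') hx₁ hx₂ h12
            fun hm => hne (le_antisymm ht.2 ((hiff t ht').1 hm).1)
        have i2 : |(∫ t in s₁..s₂, oi t) - η * j| ≤ (2 * K * L + ε) * |s₂ - s₁| := by
          have : η * j = ∫ _ in s₁..s₂, j := by
            rw [intervalIntegral.integral_const, smul_eq_mul]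
            ring
          rw [this, ← intervalIntegral.integral_sub (hii _ ms₁ _ ms₂) (by simp),
            ← Real.norm_eq_abs]
          refine intervalIntegral.norm_integral_le_of_norm_le_const fun t ht => ?_
          rw [uIoc_of_le (by linarith)] at ht
          have ht' : t ∈ Icc t₁ t₀ := ⟨ms₁.1.trans ht.1.le, ht.2.trans ms₂.2⟩
          have h1 := h.abs_outerIncrement_sub_jump_le (hsub ht') hx₁ hx₂
            ((hiff t ht').2 (Ioc_subset_Icc_self ht))
          rw [hlen] at h1
          have h2 := (hball₂ (hs t (Ioc_subset_Icc_self ht))).2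
          have h3 := abs_sub_le (oi t) (jump X fL fR t) j
          rw [Real.norm_eq_abs]
          linarith
        have i3 : |∫ t in s₂..t₀, oi t| ≤ 2 * K * L * |t₀ - s₂| := by
          rw [← Real.norm_eq_abs]
          refine intervalIntegral.norm_integral_le_of_norm_le_const fun t ht => ?_
          rw [uIoc_of_le ms₂.2] at ht
          have ht' : t ∈ Icc t₁ t₀ := ⟨ms₂.1.trans ht.1.le, ht.2⟩
          rw [← hlen]
          exact h.abs_outerIncrement_le_of_notMem (hsub ht') hx₁ hx₂ h12
            fun hm => not_le_of_gt ht.1 ((hiff t ht').1 hm).2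
        rw [← intervalIntegral.integral_add_adjacent_intervals (hii _ m1 _ ms₁) (hii _ ms₁ _ m0),
          ← intervalIntegral.integral_add_adjacent_intervals (hii _ ms₁ _ ms₂) (hii _ ms₂ _ m0)]
          at hb
        rw [abs_of_nonneg (sub_nonneg.2 ms₁.1)] at i1
        rw [abs_of_nonneg (sub_nonneg.2 ms₂.2)] at i3
        have e21 : s₂ - s₁ = η := by ring
        rw [e21, abs_of_pos hη] at i2
        have hsum : 2 * K * L * (s₁ - t₁) + (2 * K * L + ε) * η + 2 * K * L * (t₀ - s₂) =
            2 * K * L * (t₀ - t₁) + ε * η := by rw [hs₁, hs₂]; ring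
        rw [abs_le] at *
        constructor <;> linarith
      have hlim := tendsto_abs_increment_div (h.hasDerivAt_X t₀ ht₀)
      have l1 := ((hlim.const_mul (N - A)).sub_const j).abs
      have l2 := ((hlim.const_mul (2 * ε)).add
        ((hlim.const_mul (2 * K)).mul_const (t₀ - t₁))).add_const ε
      refine le_of_tendsto_of_tendsto l1 l2 ?_
      filter_upwards [Ioo_mem_nhdsGT (show (0 : ℝ) < min (δ₂ / 2) ((t₀ - t₁) / 2) from
        lt_min (half_pos hδ₂) (half_pos (sub_pos.2 ht₁)))] with η hη
      have hs := step η hη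
      have hη0 := hη.1
      set L := |X (t₀ - η) - X (t₀ - 2 * η)|
      have e1 : (N - A) * (L / η) - j = ((N - A) * L - η * j) / η := by field_simp
      have e2 : 2 * ε * (L / η) + 2 * K * (L / η) * (t₀ - t₁) + ε =
        (2 * ε * L + 2 * K * L * (t₀ - t₁) + ε * η) / η := by field_simp
      rw [e1, e2, abs_div, abs_of_pos hη0]
      exact div_le_div_of_nonneg_right hs hη0.le
    have hP' : |(N - A) * |X' t₀| - j| ≤ 2 * K * |X' t₀| * (t₀ - t₁) := by
      have hlim : Tendsto (fun ε => 2 * ε * |X' t₀| + 2 * K * |X' t₀| * (t₀ - t₁) + ε) (𝓝[>] 0)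
          (𝓝 (2 * 0 * |X' t₀| + 2 * K * |X' t₀| * (t₀ - t₁) + 0)) :=
        (Continuous.tendsto (by fun_prop) 0).mono_left nhdsWithin_le_nhds
      have := ge_of_tendsto hlim (by
        filter_upwards [self_mem_nhdsWithin] with ε hε using hP ε hε)
      simpa using this
    have hQ' : |((F - A) * |X' t₀|)| ≤ 2 * K * (t₀ - t₁) * |X' t₀| := by
      rw [abs_mul, abs_abs]
      exact mul_le_mul_of_nonneg_right hQ (abs_nonneg _)
    have e : |X' t₀| * (N - F) - j = ((N - A) * |X' t₀| - j) - (F - A) * |X' t₀| := by ring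
    rw [e]
    have := abs_sub ((N - A) * |X' t₀| - j) ((F - A) * |X' t₀|)
    linarith
  have hlim : Tendsto (fun t₁ => 4 * K * |X' t₀| * (t₀ - t₁)) (𝓝[<] t₀)
      (𝓝 (4 * K * |X' t₀| * (t₀ - t₀))) :=
    (Continuous.tendsto (by fun_prop) t₀).mono_left nhdsWithin_le_nhds
  have := ge_of_tendsto hlim (by
    filter_upwards [self_mem_nhdsWithin, Ioo_mem_nhdsLT hτ,
      Ioo_mem_nhdsLT (show t₀ - δ < t₀ by linarith)] with t₁ h1 h2 h3
    exact key t₁ h1 h3.1.le h2.1)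
  rw [sub_self, mul_zero] at this
  exact sub_eq_zero.1 (abs_nonpos_iff.1 this)

end CurveLaw

lemma eventually_lt_of_hasDerivAt_pos {f : ℝ → ℝ} {f' t₀ : ℝ} (hf : HasDerivAt f f' t₀)
    (hf' : 0 < f') : ∀ᶠ t in 𝓝[<] t₀, f t < f t₀ := by
  have h1 : ∀ᶠ t in 𝓝[<] t₀, 0 < slope f t₀ t :=
    ((hasDerivAt_iff_tendsto_slope.1 hf).mono_left
      (nhdsWithin_mono t₀ fun _ hx => ne_of_lt hx)).eventually (lt_mem_nhds hf')
  filter_upwards [h1, self_mem_nhdsWithin] with t ht hlt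
  rw [slope_def_field] at ht
  by_contra! hge
  exact absurd ht (not_lt.2 (div_nonpos_of_nonneg_of_nonpos (sub_nonneg.2 hge)
    (sub_nonpos.2 (le_of_lt hlt))))

namespace CurveLaw

variable {a b c d : ℝ} {X X' : ℝ → ℝ} {fL fR : ℝ → ℝ → ℝ} {w : ℝ → ℝ} {v : ℝ → ℝ → ℝ} {K B : ℝ}

lemma deriv_eq_jump_of_pos (h : CurveLaw a b c d X X' fL fR w v K B) {w' : ℝ → ℝ} {t₀ : ℝ}
    (ht₀ : t₀ ∈ Ioo a b) (hw : ∀ t ∈ Ioo a b, HasDerivAt w (w' t) t)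
    (hw' : ContinuousOn w' (Ioo a b)) (hpos : 0 < w t₀) : w' t₀ = jump X fL fR t₀ := by
  have e1 : ∀ᶠ t in 𝓝 t₀, 0 < w t := (hw t₀ ht₀).continuousAt.eventually (lt_mem_nhds hpos)
  obtain ⟨δ, hδ, hball⟩ := Metric.eventually_nhds_iff.1 (e1.and (isOpen_Ioo.mem_nhds ht₀))
  have hI : ∀ t ∈ Icc (t₀ - δ / 2) t₀, 0 < w t ∧ t ∈ Ioo a b := fun t ht =>
    hball (by rw [Real.dist_eq, abs_lt]; constructor <;> linarith [ht.1, ht.2])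
  have hX0 : ∀ t ∈ Icc (t₀ - δ / 2) t₀, X' t = 0 := fun t ht => by
    by_contra hne
    exact (hI t ht).1.ne' (h.w_eq_zero (hI t ht).2 hne)
  have hconst := constant_of_has_deriv_right_zero (f := X) (a := t₀ - δ / 2) (b := t₀)
    (h.continuousOn_X.mono fun t ht => (hI t ht).2)
    fun t ht => by
      rw [← hX0 t (Ico_subset_Icc_self ht)]
      exact (h.hasDerivAt_X t (hI t (Ico_subset_Icc_self ht)).2).hasDerivWithinAt
  exact h.deriv_eq_jump_of_const ht₀ (hI _ ⟨le_rfl, by linarith⟩).2 (by linarith)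
    (fun t ht => hconst t (Ioo_subset_Icc_self ht)) hw hw'

/-- The generalized Rankine–Hugoniot condition. -/
lemma jump_eq (h : CurveLaw a b c d X X' fL fR w v K B) {w' : ℝ → ℝ} {t₀ vl vr : ℝ}
    (ht₀ : t₀ ∈ Ioo a b) (hw : ∀ t ∈ Ioo a b, HasDerivAt w (w' t) t)
    (hw' : ContinuousOn w' (Ioo a b)) (hnn : ∀ t ∈ Ioo a b, 0 ≤ w t)
    (hl : Tendsto (v t₀) (𝓝[<] (X t₀)) (𝓝 vl)) (hr : Tendsto (v t₀) (𝓝[>] (X t₀)) (𝓝 vr)) :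
    jump X fL fR t₀ = w' t₀ - X' t₀ * (vr - vl) := by
  by_cases hX' : X' t₀ = 0
  · rw [hX', zero_mul, sub_zero]
    by_cases hfreq : ∃ᶠ t in 𝓝[<] t₀, X t ≠ X t₀
    · rcases (hnn t₀ ht₀).eq_or_lt with h0 | hpos
      · have hmin : IsLocalMin w t₀ := by
          filter_upwards [isOpen_Ioo.mem_nhds ht₀] with t ht
          rw [← h0]
          exact hnn t ht
        rw [hmin.hasDerivAt_eq_zero (hw t₀ ht₀)]
        refine h.jump_eq_zero_of_frequently (C₀ := max (|vl| + 1) (|vr| + 1)) ht₀ hX' hfreq ?_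
        have e1 := eventually_nhdsWithin_iff.1
          (hl.abs.eventually (gt_mem_nhds (lt_add_one |vl|)))
        have e2 := eventually_nhdsWithin_iff.1
          (hr.abs.eventually (gt_mem_nhds (lt_add_one |vr|)))
        filter_upwards [e1, e2] with x h1 h2 hx
        rcases lt_or_gt_of_ne hx with hlt | hlt
        · exact (h1 hlt).le.trans (le_max_left _ _)
        · exact (h2 hlt).le.trans (le_max_right _ _)
      · exact (h.deriv_eq_jump_of_pos ht₀ hw hw' hpos).symm
    · simp only [not_frequently, not_not] at hfreq
      obtain ⟨s, hs, hsX⟩ := (mem_nhdsLT_iff_exists_Ioo_subset' ht₀.1).1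
        (hfreq.and (Ioo_mem_nhdsLT ht₀.1))
      obtain ⟨s', hs', hs't⟩ := exists_between (mem_Iio.1 hs)
      exact (h.deriv_eq_jump_of_const ht₀
          (hsX ⟨hs', hs't⟩ |>.2 |> fun hm => ⟨hm.1, hm.2.trans ht₀.2⟩)
        hs't (fun t ht => (hsX ⟨hs'.trans ht.1, ht.2⟩).1) hw hw').symm
  · have hw0 : w =ᶠ[𝓝 t₀] fun _ => 0 := by
      filter_upwards [isOpen_Ioo.mem_nhds ht₀,
        (h.continuousOn_X'.continuousAt (isOpen_Ioo.mem_nhds ht₀)).eventually_ne hX'] with t h1 h2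
      exact h.w_eq_zero h1 h2
    rw [(hw t₀ ht₀).unique ((hasDerivAt_const t₀ 0).congr_of_eventuallyEq hw0)]
    rcases lt_or_gt_of_ne hX' with hneg | hpos
    · have hS : ∀ᶠ t in 𝓝[<] t₀, X t ∈ Ioi (X t₀) := by
        filter_upwards [eventually_lt_of_hasDerivAt_pos (h.hasDerivAt_X t₀ ht₀).neg
          (neg_pos.2 hneg)] with t ht
        exact neg_lt_neg_iff.1 ht
      rw [← h.abs_speed_mul_sub_eq_jump ht₀ hX' ordConnected_Ioi
        (disjoint_left.2 fun x h1 h2 => lt_asymm (mem_Ioi.1 h1) (mem_Iio.1 h2))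
        self_notMem_Iio hS hr hl, abs_of_neg hneg]
      ring
    · have hS : ∀ᶠ t in 𝓝[<] t₀, X t ∈ Iio (X t₀) :=
        eventually_lt_of_hasDerivAt_pos (h.hasDerivAt_X t₀ ht₀) hpos
      rw [← h.abs_speed_mul_sub_eq_jump ht₀ hX' ordConnected_Iio
        (disjoint_left.2 fun x h1 h2 => lt_asymm (mem_Ioi.1 h2) (mem_Iio.1 h1))
        self_notMem_Ioi hS hl hr, abs_of_pos hpos]
      ring

end CurveLaw

lemma ContDiffOn.exists_lip_bound {a b c d : ℝ} {f : ℝ → ℝ → ℝ}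
    (hf : ContDiffOn ℝ 1 (fun q : ℝ × ℝ => f q.1 q.2) (Icc a b ×ˢ Icc c d)) :
    ∃ K B : ℝ, (∀ t ∈ Icc a b, ∀ x ∈ Icc c d, ∀ y ∈ Icc c d, |f t x - f t y| ≤ K * |x - y|) ∧
      ∀ t ∈ Icc a b, ∀ x ∈ Icc c d, |f t x| ≤ B := by
  have hc : IsCompact (Icc a b ×ˢ Icc c d) := isCompact_Icc.prod isCompact_Icc
  obtain ⟨K, hK⟩ := LocallyLipschitzOn.exists_lipschitzOnWith_of_compact hc fun q hq =>
    (hf q hq).exists_lipschitzOnWith ((convex_Icc a b).prod (convex_Icc c d))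
  obtain ⟨B, hB⟩ := hc.exists_bound_of_continuousOn hf.continuousOn
  refine ⟨K, B, fun t ht x hx y hy => ?_, fun t ht x hx => hB (t, x) ⟨ht, hx⟩⟩
  have := hK.dist_le_mul (t, x) ⟨ht, hx⟩ (t, y) ⟨ht, hy⟩
  simpa [Prod.dist_eq, Real.dist_eq] using this

lemma continuousAt_of_forall_lt_of_forall_gt {X : ℝ → ℝ} {gL gR g : ℝ → ℝ → ℝ} {t x : ℝ}
    (hX : ContinuousAt X t) (hne : x ≠ X t)
    (hL : ContinuousAt (fun q : ℝ × ℝ => gL q.1 q.2) (t, x))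
    (hR : ContinuousAt (fun q : ℝ × ℝ => gR q.1 q.2) (t, x))
    (hg : ∀ t x, (x < X t → g t x = gL t x) ∧ (X t < x → g t x = gR t x)) :
    ContinuousAt (fun q : ℝ × ℝ => g q.1 q.2) (t, x) := by
  have hXc : ContinuousAt (fun q : ℝ × ℝ => X q.1) (t, x) :=
    ContinuousAt.comp (g := X) (f := Prod.fst) hX continuousAt_fst
  rcases lt_or_gt_of_ne hne with hlt | hlt
  · refine hL.congr ?_
    filter_upwards [continuousAt_snd.eventually_lt hXc hlt] with q hq
    exact ((hg q.1 q.2).1 hq).symm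
  · refine hR.congr ?_
    filter_upwards [hXc.eventually_lt continuousAt_snd hlt] with q hq
    exact ((hg q.1 q.2).2 hq).symm

lemma glued_spec (X : ℝ → ℝ) (gL gR : ℝ → ℝ → ℝ) (t x : ℝ) :
    (x < X t → glued X gL gR t x = gL t x) ∧ (X t < x → glued X gL gR t x = gR t x) :=
  ⟨fun hx => if_pos hx, fun hx => if_neg hx.not_gt⟩

lemma integral_mul_eq_integral_glued_mul {X : ℝ → ℝ} {gL gR g : ℝ → ℝ → ℝ}
    (hg : ∀ t x, (x < X t → g t x = gL t x) ∧ (X t < x → g t x = gR t x)) (t : ℝ) (s : Set ℝ)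
    (β : ℝ → ℝ) : ∫ x in s, g t x * β x = ∫ x in s, glued X gL gR t x * β x := by
  refine integral_congr_ae ?_
  filter_upwards [ae_restrict_of_ae (Measure.ae_ne volume (X t))] with x hx
  rcases lt_or_gt_of_ne hx with hlt | hlt
  · rw [(hg t x).1 hlt, (glued_spec X gL gR t x).1 hlt]
  · rw [(hg t x).2 hlt, (glued_spec X gL gR t x).2 hlt]

/-- A distributional solution restricts to a `CurveLaw` on a neighbourhood of every time. -/
lemma exists_curveLaw {a b c d : ℝ} {X X' : ℝ → ℝ} {fL fR : ℝ → ℝ → ℝ} {w : ℝ → ℝ}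
    {v : ℝ → ℝ → ℝ} {t₀ : ℝ} (ht₀ : t₀ ∈ Ioo a b)
    (hX : ∀ t ∈ Icc a b, HasDerivWithinAt X (X' t) (Icc a b) t)
    (hX' : ContinuousOn X' (Icc a b)) (hXmem : ∀ t ∈ Icc a b, X t ∈ Ioo c d)
    (hfL : ContDiffOn ℝ 1 (fun q : ℝ × ℝ => fL q.1 q.2) (Icc a b ×ˢ Icc c d))
    (hfR : ContDiffOn ℝ 1 (fun q : ℝ × ℝ => fR q.1 q.2) (Icc a b ×ˢ Icc c d))
    (hw : ContinuousOn w (Ioo a b))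
    (hv : ∀ t ∈ Ioo a b, ∀ x ∈ Ioo c d, x ≠ X t →
      ContinuousAt (fun q : ℝ × ℝ => v q.1 q.2) (t, x))
    (hvint : IntegrableOn (fun q : ℝ × ℝ => v q.1 q.2) (Ioo a b ×ˢ Ioo c d))
    (hweak : ∀ φ : ℝ → ℝ → ℝ,
      ContDiff ℝ (⊤ : ℕ∞) (fun q : ℝ × ℝ => φ q.1 q.2) →
      HasCompactSupport (fun q : ℝ × ℝ => φ q.1 q.2) →
      tsupport (fun q : ℝ × ℝ => φ q.1 q.2) ⊆ Ioo a b ×ˢ Ioo c d →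
      (∫ t in Ioo a b, ∫ x in Ioo c d, v t x * deriv (fun s => φ s x) t) +
        (∫ t in Ioo a b, w t * deriv (fun s => φ s (X t)) t) =
        ∫ t in Ioo a b, ∫ x in Ioo c d, glued X fL fR t x * deriv (fun y => φ t y) x) :
    ∃ a' b' K B : ℝ, t₀ ∈ Ioo a' b' ∧ Ioo a' b' ⊆ Ioo a b ∧
      CurveLaw a' b' c d X X' fL fR w v K B := by
  obtain ⟨a', ha, ha'⟩ := exists_between ht₀.1
  obtain ⟨b', hb', hb⟩ := exists_between ht₀.2
  obtain ⟨KL, BL, hKL, hBL⟩ := hfL.exists_lip_bound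
  obtain ⟨KR, BR, hKR, hBR⟩ := hfR.exists_lip_bound
  have hIcc : Icc a' b' ⊆ Ioo a b := Icc_subset_Ioo ha hb
  obtain ⟨Bw, hBw⟩ := isCompact_Icc.exists_bound_of_continuousOn (hw.mono hIcc)
  have hI : Ioo a' b' ⊆ Ioo a b := Ioo_subset_Icc_self.trans hIcc
  have hI' : Ioo a' b' ⊆ Icc a b := hI.trans Ioo_subset_Icc_self
  have hJ : Ioo c d ⊆ Icc c d := Ioo_subset_Icc_self
  refine ⟨a', b', max KL KR, max (max BL BR) Bw, ⟨ha', hb'⟩, hI,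
    { hasDerivAt_X := fun t ht => (hX t (hI' ht)).hasDerivAt (Icc_mem_nhds (hI ht).1 (hI ht).2)
      continuousOn_X' := hX'.mono hI'
      X_mem := fun t ht => hXmem t (hI' ht)
      fL_cont := hfL.continuousOn.mono (prod_mono hI' hJ)
      fR_cont := hfR.continuousOn.mono (prod_mono hI' hJ)
      fL_lip := fun t ht x hx y hy => (hKL t (hI' ht) x (hJ hx) y (hJ hy)).trans
        (mul_le_mul_of_nonneg_right (le_max_left _ _) (abs_nonneg _))
      fR_lip := fun t ht x hx y hy => (hKR t (hI' ht) x (hJ hx) y (hJ hy)).trans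
        (mul_le_mul_of_nonneg_right (le_max_right _ _) (abs_nonneg _))
      fL_bdd := fun t ht x hx => (hBL t (hI' ht) x (hJ hx)).trans
        ((le_max_left _ _).trans (le_max_left _ _))
      fR_bdd := fun t ht x hx => (hBR t (hI' ht) x (hJ hx)).trans
        ((le_max_right _ _).trans (le_max_left _ _))
      w_cont := hw.mono hI
      w_bdd := fun t ht => (hBw t (Ioo_subset_Icc_self ht)).trans (le_max_right _ _)
      v_cont := fun t ht => hv t (hI ht)
      v_int := hvint.mono_set (prod_mono hI subset_rfl)
      weak := ?_ }⟩
  intro α β hα hβ hαc hβc hαs hβs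
  have hφ0 : ∀ q ∉ tsupport α ×ˢ tsupport β, α q.1 * β q.2 = 0 := fun q hq => by
    rw [mem_prod, not_and_or] at hq
    rcases hq with hq | hq
    · rw [image_eq_zero_of_notMem_tsupport hq, zero_mul]
    · rw [image_eq_zero_of_notMem_tsupport hq, mul_zero]
  have hφs : tsupport (fun q : ℝ × ℝ => α q.1 * β q.2) ⊆ Ioo a b ×ˢ Ioo c d :=
    (closure_minimal (Function.support_subset_iff'.2 hφ0)
      ((isClosed_tsupport α).prod (isClosed_tsupport β))).trans
      (prod_mono (hαs.trans hI) hβs)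
  have key := hweak (fun t x => α t * β x)
    ((hα.comp contDiff_fst).mul (hβ.comp contDiff_snd))
    (HasCompactSupport.intro (hαc.isCompact.prod hβc.isCompact) hφ0) hφs
  have hα0 : ∀ t ∈ Ioo a b \ Ioo a' b', α t = 0 := fun t ht =>
    image_eq_zero_of_notMem_tsupport fun h => ht.2 (hαs h)
  have hα'0 : ∀ t ∈ Ioo a b \ Ioo a' b', deriv α t = 0 := fun t ht =>
    image_eq_zero_of_notMem_tsupport fun h => ht.2 (hαs (tsupport_deriv_subset h))
  simp only [deriv_mul_const_field, deriv_const_mul_field, mul_left_comm _ (deriv α _) (β _),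
    mul_left_comm _ (α _) (deriv β _), integral_const_mul] at key
  rw [setIntegral_eq_of_subset_of_forall_sdiff_eq_zero measurableSet_Ioo hI
      fun t ht => by rw [hα'0 t ht, zero_mul],
    setIntegral_eq_of_subset_of_forall_sdiff_eq_zero measurableSet_Ioo hI
      fun t ht => by rw [hα'0 t ht, zero_mul],
    setIntegral_eq_of_subset_of_forall_sdiff_eq_zero measurableSet_Ioo hI
      fun t ht => by rw [hα0 t ht, zero_mul]] at key
  simpa only [mul_left_comm (w _) (deriv α _)] using key

/-- Generalized Rankine–Hugoniot conditions for the p-system with a vacuum: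
if the Lagrangian gas dynamics equations hold distributionally on
`𝒰 = (a,b) × (c,d)` with specific volume measure `V(t) = v(t,·)dx + w(t)δ_{X(t)}`,
velocity `u` and pressure `p` piecewise `C¹` across the curve `x = X(t)`, then
(i) `w(t)X'(t) = 0`; (ii) `X'(t)[u] = [p]`; (iii) wherever the one-sided limits of
`v` are finite, `[u] = w' − X'[v]`; and at any time with `w(t) > 0` one has
`X'(t) = 0` and `w'(t) = [u](t)`. -/
theorem p_system_generalized_rankine_hugoniot
    (a b c d : ℝ) (hab : a < b) (hcd : c < d)
    (X X' : ℝ → ℝ)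
    (hX : ∀ t ∈ Icc a b, HasDerivWithinAt X (X' t) (Icc a b) t)
    (hX'cont : ContinuousOn X' (Icc a b))
    (hXmem : ∀ t ∈ Icc a b, X t ∈ Ioo c d)
    (uL uR pL pR : ℝ → ℝ → ℝ)
    (huL : ContDiffOn ℝ 1 (fun q : ℝ × ℝ => uL q.1 q.2) (Icc a b ×ˢ Icc c d))
    (huR : ContDiffOn ℝ 1 (fun q : ℝ × ℝ => uR q.1 q.2) (Icc a b ×ˢ Icc c d))
    (hpL : ContDiffOn ℝ 1 (fun q : ℝ × ℝ => pL q.1 q.2) (Icc a b ×ˢ Icc c d))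
    (hpR : ContDiffOn ℝ 1 (fun q : ℝ × ℝ => pR q.1 q.2) (Icc a b ×ˢ Icc c d))
    (w w' : ℝ → ℝ)
    (hw : ∀ t ∈ Ioo a b, HasDerivAt w (w' t) t)
    (hw'cont : ContinuousOn w' (Ioo a b))
    (hwnonneg : ∀ t ∈ Ioo a b, 0 ≤ w t)
    (vL vR : ℝ → ℝ → ℝ)
    (hvL : ∀ t ∈ Ioo a b, ∀ x ∈ Ioo c d, x ≠ X t →
        ContDiffAt ℝ 1 (fun q : ℝ × ℝ => vL q.1 q.2) (t, x))
    (hvR : ∀ t ∈ Ioo a b, ∀ x ∈ Ioo c d, x ≠ X t →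
        ContDiffAt ℝ 1 (fun q : ℝ × ℝ => vR q.1 q.2) (t, x))
    (u v p : ℝ → ℝ → ℝ)
    (hu : ∀ t x, (x < X t → u t x = uL t x) ∧ (X t < x → u t x = uR t x))
    (hv : ∀ t x, (x < X t → v t x = vL t x) ∧ (X t < x → v t x = vR t x))
    (hp : ∀ t x, (x < X t → p t x = pL t x) ∧ (X t < x → p t x = pR t x))
    (hvint : IntegrableOn (fun q : ℝ × ℝ => v q.1 q.2) (Ioo a b ×ˢ Ioo c d))
    (heqI : ∀ φ : ℝ → ℝ → ℝ,
        ContDiff ℝ (⊤ : ℕ∞) (fun q : ℝ × ℝ => φ q.1 q.2) →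
        HasCompactSupport (fun q : ℝ × ℝ => φ q.1 q.2) →
        tsupport (fun q : ℝ × ℝ => φ q.1 q.2) ⊆ Ioo a b ×ˢ Ioo c d →
        (∫ t in Ioo a b, ∫ x in Ioo c d, v t x * deriv (fun s => φ s x) t) +
          (∫ t in Ioo a b, w t * deriv (fun s => φ s (X t)) t) =
          ∫ t in Ioo a b, ∫ x in Ioo c d, u t x * deriv (fun y => φ t y) x)
    (heqII : ∀ φ : ℝ → ℝ → ℝ,
        ContDiff ℝ (⊤ : ℕ∞) (fun q : ℝ × ℝ => φ q.1 q.2) →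
        HasCompactSupport (fun q : ℝ × ℝ => φ q.1 q.2) →
        tsupport (fun q : ℝ × ℝ => φ q.1 q.2) ⊆ Ioo a b ×ˢ Ioo c d →
        (∫ t in Ioo a b, ∫ x in Ioo c d, u t x * deriv (fun s => φ s x) t) +
          (∫ t in Ioo a b, ∫ x in Ioo c d, p t x * deriv (fun y => φ t y) x) = 0) :
    (∀ t ∈ Ioo a b, w t * X' t = 0) ∧
    (∀ t ∈ Ioo a b,
        X' t * (uR t (X t) - uL t (X t)) = pR t (X t) - pL t (X t)) ∧
    (∀ t ∈ Ioo a b, ∀ vl vr : ℝ,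
        Tendsto (fun x => vL t x) (𝓝[<] (X t)) (𝓝 vl) →
        Tendsto (fun x => vR t x) (𝓝[>] (X t)) (𝓝 vr) →
        uR t (X t) - uL t (X t) = w' t - X' t * (vr - vl)) ∧
    (∀ t ∈ Ioo a b, 0 < w t →
        X' t = 0 ∧ w' t = uR t (X t) - uL t (X t)) := by
  have hIcc : ∀ t ∈ Ioo a b, Icc a b ∈ 𝓝 t := fun t ht => Icc_mem_nhds ht.1 ht.2
  have hXc : ∀ t ∈ Ioo a b, ContinuousAt X t := fun t ht =>
    ((hX t (Ioo_subset_Icc_self ht)).hasDerivAt (hIcc t ht)).continuousAt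
  have hXt : ∀ t ∈ Ioo a b, X t ∈ Ioo c d := fun t ht => hXmem t (Ioo_subset_Icc_self ht)
  have hcont : ∀ f : ℝ → ℝ → ℝ,
      ContDiffOn ℝ 1 (fun q : ℝ × ℝ => f q.1 q.2) (Icc a b ×ˢ Icc c d) →
      ∀ t ∈ Ioo a b, ∀ x ∈ Ioo c d, ContinuousAt (fun q : ℝ × ℝ => f q.1 q.2) (t, x) :=
    fun f hf t ht x hx => hf.continuousOn.continuousAt
      (prod_mem_nhds (hIcc t ht) (Icc_mem_nhds hx.1 hx.2))
  have hslice : ∀ f : ℝ → ℝ → ℝ,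
      ContDiffOn ℝ 1 (fun q : ℝ × ℝ => f q.1 q.2) (Icc a b ×ˢ Icc c d) →
      ∀ t ∈ Ioo a b, ContinuousAt (f t) (X t) := fun f hf t ht =>
    ContinuousAt.comp (f := fun x => (t, x)) (hcont f hf t ht _ (hXt t ht)) (by fun_prop)
  have hside : ∀ g gL gR : ℝ → ℝ → ℝ,
      (∀ t x, (x < X t → g t x = gL t x) ∧ (X t < x → g t x = gR t x)) →
      ∀ t, (gL t =ᶠ[𝓝[<] (X t)] g t) ∧ (gR t =ᶠ[𝓝[>] (X t)] g t) := fun g gL gR hg t =>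
    ⟨by filter_upwards [self_mem_nhdsWithin] with x hx using ((hg t x).1 hx).symm,
      by filter_upwards [self_mem_nhdsWithin] with x hx using ((hg t x).2 hx).symm⟩
  have hlawI : ∀ t ∈ Ioo a b, ∃ a' b' K B : ℝ, t ∈ Ioo a' b' ∧ Ioo a' b' ⊆ Ioo a b ∧
      CurveLaw a' b' c d X X' uL uR w v K B := fun t ht =>
    exists_curveLaw ht hX hX'cont hXmem huL huR
      (fun s hs => (hw s hs).continuousAt.continuousWithinAt)
      (fun s hs x hx hne => continuousAt_of_forall_lt_of_forall_gt (hXc s hs) hne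
        (hvL s hs x hx hne).continuousAt (hvR s hs x hx hne).continuousAt hv) hvint
      fun φ h1 h2 h3 => by
        simpa only [integral_mul_eq_integral_glued_mul hu] using heqI φ h1 h2 h3
  have hlawII : ∀ t ∈ Ioo a b, ∃ a' b' K B : ℝ, t ∈ Ioo a' b' ∧ Ioo a' b' ⊆ Ioo a b ∧
      CurveLaw a' b' c d X X' (fun t x => -pL t x) (fun t x => -pR t x) (fun _ => 0)
        (glued X uL uR) K B := fun t ht => by
    obtain ⟨-, BL, -, hBL⟩ := huL.exists_lip_bound
    obtain ⟨-, BR, -, hBR⟩ := huR.exists_lip_bound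
    refine exists_curveLaw ht hX hX'cont hXmem hpL.neg hpR.neg continuousOn_const
      (fun s hs x hx hne => continuousAt_of_forall_lt_of_forall_gt (hXc s hs) hne
        (hcont uL huL s hs x hx) (hcont uR huR s hs x hx) (glued_spec X uL uR))
      (glued_integrableOn (B := max BL BR) (fun s hs => (hXc s hs).continuousWithinAt)
        (huL.continuousOn.mono (prod_mono Ioo_subset_Icc_self Ioo_subset_Icc_self))
        (huR.continuousOn.mono (prod_mono Ioo_subset_Icc_self Ioo_subset_Icc_self))
        fun s hs x hx => ?_) fun φ h1 h2 h3 => ?_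
    · have hs' := Ioo_subset_Icc_self hs
      have hx' := Ioo_subset_Icc_self hx
      unfold glued
      split_ifs
      · exact (hBL s hs' x hx').trans (le_max_left _ _)
      · exact (hBR s hs' x hx').trans (le_max_right _ _)
    · have hneg : ∀ s x, glued X (fun t x => -pL t x) (fun t x => -pR t x) s x =
          -glued X pL pR s x := fun s x => by
        unfold glued
        split_ifs <;> rfl
      have key := heqII φ h1 h2 h3
      simp only [integral_mul_eq_integral_glued_mul hu,
        integral_mul_eq_integral_glued_mul hp] at key
      simp only [hneg, neg_mul, integral_neg, zero_mul, integral_zero, add_zero]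
      exact eq_neg_of_add_eq_zero_left key
  have hzero : ∀ t ∈ Ioo a b, X' t ≠ 0 → w t = 0 := fun t ht hne => by
    obtain ⟨a', b', K, B, ht', -, h⟩ := hlawI t ht
    exact h.w_eq_zero ht' hne
  refine ⟨fun t ht => ?_, fun t ht => ?_, fun t ht vl vr hl hr => ?_, fun t ht hpos => ⟨?_, ?_⟩⟩
  · by_cases hne : X' t = 0
    · rw [hne, mul_zero]
    · rw [hzero t ht hne, zero_mul]
  · obtain ⟨a', b', K, B, ht', -, h⟩ := hlawII t ht
    have hg := hside _ _ _ (glued_spec X uL uR) t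
    have := h.jump_eq (w' := fun _ => 0) ht' (fun s _ => hasDerivAt_const s _)
      continuousOn_const (fun _ _ => le_rfl)
      (((hslice uL huL t ht).tendsto.mono_left nhdsWithin_le_nhds).congr' hg.1)
      (((hslice uR huR t ht).tendsto.mono_left nhdsWithin_le_nhds).congr' hg.2)
    simp only [jump] at this
    linarith
  · obtain ⟨a', b', K, B, ht', hsub, h⟩ := hlawI t ht
    have hg := hside _ _ _ hv t
    exact h.jump_eq ht' (fun s hs => hw s (hsub hs)) (hw'cont.mono hsub)
      (fun s hs => hwnonneg s (hsub hs)) (hl.congr' hg.1) (hr.congr' hg.2)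
  · by_contra hne
    exact hpos.ne' (hzero t ht hne)
  · obtain ⟨a', b', K, B, ht', hsub, h⟩ := hlawI t ht
    exact h.deriv_eq_jump_of_pos ht' (fun s hs => hw s (hsub hs)) (hw'cont.mono hsub) hpos
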